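/- arXiv:1205.0090 — 4 statements merged into one kernel-verified Lean document; each statement's English description precedes it below -/
import Mathlib

section
/- Let f ∈ C⁴([a,b]) be real-valued and g ∈ C³([a,b]) be complex-valued. Suppose there are positive constants T, M, N, U, C₂₋, C₂, C₃, C₄, C_M, D₀, D₁, D₂ and 0 < δ < 1 such that for all z ∈ [a,b]: f''(z) ≥ T/(C₂₋·M²); |f^{(j)}(z)| ≤ C_j·T/M^j for j = 2, 3, 4; |g^{(j)}(z)| ≤ D_j·U/N^j for j = 0, 1, 2; b − a ≤ C_M·M; and f'(c) = 0 for some c ∈ [a,b]. Set β := 3δ/(C₂₋C₃). Then, with implicit constants depending only on C₂₋, C₂, C₃, C₄, C_M, D₀, D₁, D₂, δ: (i) if 0 < c − a ≤ β·M, then ∫_a^c g(x)e(f(x)) dx = g(c)e(f(c) + 1/8)/(2√(f''(c))) − g(c)f'''(c)e(f(c))/(6πi·f''(c)²) − g(a)e(f(a))/(2πi·f'(a)) + g'(c)e(f(c))/(2πi·f''(c)) + O(U·M⁴/(T²(c−a)³)) + O((U·M/T^{3/2})·(1 + M/N)²); (ii) if 0 < b − c ≤ β·M, then ∫_c^b g(x)e(f(x))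 dx = g(c)e(f(c) + 1/8)/(2√(f''(c))) + g(c)f'''(c)e(f(c))/(6πi·f''(c)²) + g(b)e(f(b))/(2πi·f'(b)) − g'(c)e(f(c))/(2πi·f''(c)) + O(U·M⁴/(T²(b−c)³)) + O((U·M/T^{3/2})·(1 + M/N)²). -/
open Complex Filter Set

noncomputable section

/-- `ee x = exp (2 π i x)`. -/
def ee (x : ℝ) : ℂ := Complex.exp (2 * Real.pi * Complex.I * x)

open Topology MeasureTheory

/-- If `F` tends to `0` at `0` from the right and `‖F'(t)‖ ≤ C t ^ m`, then
`‖F x‖ ≤ C x ^ (m + 1)`. -/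
lemma norm_le_pow_of_deriv_le {E : Type*} [NormedAddCommGroup E] [NormedSpace ℝ E]
    {F F' : ℝ → E} {h C : ℝ} {m : ℕ} (hC : 0 ≤ C)
    (hF : ∀ x ∈ Ioc 0 h, HasDerivWithinAt F (F' x) (Icc 0 h) x)
    (hF' : ∀ x ∈ Ioc 0 h, ‖F' x‖ ≤ C * x ^ m)
    (h0 : Tendsto F (𝓝[>] 0) (𝓝 0)) :
    ∀ x ∈ Ioc 0 h, ‖F x‖ ≤ C * x ^ (m + 1) := by
  intro x hx
  have key : ∀ ε ∈ Ioo 0 x, ‖F x - F ε‖ ≤ C * x ^ m * x := by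
    intro ε hε
    have h1 : ‖F x - F ε‖ ≤ C * x ^ m * ‖x - ε‖ := by
      refine (convex_Icc ε x).norm_image_sub_le_of_norm_hasDerivWithin_le (f' := F') ?_ ?_
        (left_mem_Icc.2 hε.2.le) (right_mem_Icc.2 hε.2.le)
      · intro y hy
        exact (hF y ⟨hε.1.trans_le hy.1, hy.2.trans hx.2⟩).mono
          (Icc_subset_Icc hε.1.le hx.2)
      · intro y hy
        have hy0 : 0 < y := hε.1.trans_le hy.1
        refine (hF' y ⟨hy0, hy.2.trans hx.2⟩).trans ?_
        have := hy.2
        gcongr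
    refine h1.trans ?_
    have : ‖x - ε‖ ≤ x := by
      rw [Real.norm_of_nonneg (by linarith [hε.2])]; linarith [hε.1]
    have := hx.1
    gcongr
  have hlim : Tendsto (fun ε => ‖F x - F ε‖) (𝓝[>] 0) (𝓝 ‖F x - 0‖) :=
    (tendsto_const_nhds.sub h0).norm
  have := le_of_tendsto hlim (by
    filter_upwards [Ioo_mem_nhdsGT hx.1] with ε hε using key ε hε)
  rw [sub_zero] at this
  calc ‖F x‖ ≤ _ := this
    _ = _ := by ring

/-- If `F 0 = 0` and `|F'(t)| ≤ C t ^ m` on `[0, h]`, then `|F x| ≤ C x ^ (m + 1)`. -/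
lemma abs_le_pow_of_deriv_le {F F' : ℝ → ℝ} {h C : ℝ} {m : ℕ} (hC : 0 ≤ C)
    (hF : ∀ x ∈ Icc 0 h, HasDerivWithinAt F (F' x) (Icc 0 h) x) (h0 : F 0 = 0)
    (hF' : ∀ x ∈ Icc 0 h, |F' x| ≤ C * x ^ m) :
    ∀ x ∈ Icc 0 h, |F x| ≤ C * x ^ (m + 1) := by
  intro x hx
  rcases hx.1.eq_or_lt with rfl | hx0
  · simp [h0]
  refine norm_le_pow_of_deriv_le (F' := F') hC (fun y hy => hF y (Ioc_subset_Icc_self hy))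
    (fun y hy => hF' y (Ioc_subset_Icc_self hy)) ?_ x ⟨hx0, hx.2⟩
  have h1 := (hF 0 ⟨le_rfl, hx.1.trans hx.2⟩).continuousWithinAt
  have h2 : ContinuousWithinAt F (Ioc 0 h) 0 := h1.mono Ioc_subset_Icc_self
  have h3 : ContinuousWithinAt F (Ioi 0) 0 :=
    h2.mono_of_mem_nhdsWithin (Ioc_mem_nhdsGT (hx0.trans_le hx.2))
  simpa [ContinuousWithinAt, h0] using h3

/-- Two functions that agree at `0` and whose derivatives on `[0, h]` are ordered are themselves
ordered on `[0, h]`. -/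
lemma le_of_le_deriv {F F' G G' : ℝ → ℝ} {h : ℝ}
    (hF : ∀ x ∈ Icc 0 h, HasDerivWithinAt F (F' x) (Icc 0 h) x)
    (hG : ∀ x ∈ Icc 0 h, HasDerivWithinAt G (G' x) (Icc 0 h) x) (h0 : F 0 = G 0)
    (hFG : ∀ x ∈ Icc 0 h, F' x ≤ G' x) : ∀ x ∈ Icc 0 h, F x ≤ G x := by
  intro x hx
  have hmono : MonotoneOn (fun x => G x - F x) (Icc 0 h) := by
    refine monotoneOn_of_hasDerivWithinAt_nonneg (f' := fun x => G' x - F' x) (convex_Icc 0 h) ?_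
      ?_ ?_
    · intro y hy
      exact (hG y hy).continuousWithinAt.sub (hF y hy).continuousWithinAt
    · intro y hy
      exact ((hG y (interior_subset hy)).sub (hF y (interior_subset hy))).mono interior_subset
    · intro y hy
      exact sub_nonneg.2 (hFG y (interior_subset hy))
  have := hmono ⟨le_rfl, hx.1.trans hx.2⟩ hx hx.1
  simp only [h0] at this
  linarith

lemma hasDerivAt_gaussian_tail_primitive {b : ℂ} (hb : b ≠ 0) {s : ℝ} (hs : 0 < s) :
    HasDerivAt (fun s : ℝ => cexp (-b * s ^ 2) * (-1 / (2 * b * s) + 1 / (4 * b ^ 2 * s ^ 3)))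
      (cexp (-b * s ^ 2) - cexp (-b * s ^ 2) * (3 / (4 * b ^ 2 * s ^ 4))) s := by
  have hs' : (s : ℂ) ≠ 0 := by exact_mod_cast hs.ne'
  have h1 : HasDerivAt (fun z : ℂ => cexp (-b * z ^ 2) *
      (-1 / (2 * b * z) + 1 / (4 * b ^ 2 * z ^ 3)))
      (cexp (-b * s ^ 2) - cexp (-b * s ^ 2) * (3 / (4 * b ^ 2 * s ^ 4))) (s : ℂ) := by
    have e1 : HasDerivAt (fun z : ℂ => cexp (-b * z ^ 2)) (cexp (-b * s ^ 2) * (-b * (2 * s))) s := by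
      have := ((hasDerivAt_pow 2 (s : ℂ)).const_mul (-b)).cexp
      simpa using this
    have e2 : HasDerivAt (fun z : ℂ => -1 / (2 * b * z)) (1 / (2 * b * s ^ 2)) (s : ℂ) := by
      have := (hasDerivAt_const (s : ℂ) (-1 : ℂ)).div ((hasDerivAt_id (s : ℂ)).const_mul (2 * b))
        (by simp [hb, hs'])
      refine this.congr_deriv ?_
      simp only [id]
      field_simp
      ring
    have e3 : HasDerivAt (fun z : ℂ => 1 / (4 * b ^ 2 * z ^ 3)) (-3 / (4 * b ^ 2 * s ^ 4)) (s : ℂ) := by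
      have := (hasDerivAt_const (s : ℂ) (1 : ℂ)).div ((hasDerivAt_pow 3 (s : ℂ)).const_mul (4 * b ^ 2))
        (by simp [hb, hs'])
      refine this.congr_deriv ?_
      push_cast
      field_simp
      ring
    refine (e1.mul (e2.add e3)).congr_deriv ?_
    simp only [Pi.add_apply]
    field_simp
    ring
  exact h1.comp_ofReal

lemma norm_gaussian_le_one {b : ℂ} (hb : 0 < b.re) (s : ℝ) : ‖cexp (-b * s ^ 2)‖ ≤ 1 := by
  rw [Complex.norm_exp, ← ofReal_pow, Complex.re_mul_ofReal, neg_re]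
  exact Real.exp_le_one_iff.2 (by nlinarith [sq_nonneg s])

lemma norm_gaussian_tail_le {b : ℂ} (hb : 0 < b.re) {X : ℝ} (hX : 0 < X) :
    ‖(∫ s in Ioi X, cexp (-b * s ^ 2)) - cexp (-b * X ^ 2) / (2 * b * X)‖
      ≤ 1 / (‖b‖ ^ 2 * X ^ 3) := by
  have hb0 : b ≠ 0 := by rintro rfl; simp at hb
  have hint : IntegrableOn (fun s : ℝ => cexp (-b * s ^ 2)) (Ioi X) :=
    (integrable_cexp_neg_mul_sq hb).integrableOn
  have hdecay : IntegrableOn (fun s : ℝ => s ^ (-4 : ℝ)) (Ioi X) :=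
    integrableOn_Ioi_rpow_of_lt (by norm_num) hX
  have hbound : ∀ s ∈ Ioi X, ‖cexp (-b * s ^ 2) * (3 / (4 * b ^ 2 * s ^ 4))‖
      ≤ 3 / (4 * ‖b‖ ^ 2) * s ^ (-4 : ℝ) := by
    intro s hs
    have hs0 : 0 < s := hX.trans hs
    rw [norm_mul, norm_div, norm_mul, norm_mul, norm_pow, norm_pow, Complex.norm_real,
      Real.norm_of_nonneg hs0.le, Real.rpow_neg hs0.le]
    have h4 : s ^ (4 : ℝ) = s ^ 4 := by exact_mod_cast Real.rpow_natCast s 4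
    rw [h4]
    have := norm_gaussian_le_one hb s
    calc _ ≤ 1 * (‖(3 : ℂ)‖ / (‖(4 : ℂ)‖ * ‖b‖ ^ 2 * s ^ 4)) := by gcongr
      _ = _ := by
        have : ‖b‖ ≠ 0 := norm_ne_zero_iff.2 hb0
        norm_num
        field_simp
  have hcont : ContinuousOn (fun s : ℝ => cexp (-b * s ^ 2) * (3 / (4 * b ^ 2 * s ^ 4))) (Ioi X) := by
    refine ContinuousOn.mul (by fun_prop) (ContinuousOn.div (by fun_prop) (by fun_prop) ?_)
    intro s hs
    have : (s : ℂ) ≠ 0 := by exact_mod_cast (hX.trans hs).ne'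
    simp [hb0, this]
  have hint2 : IntegrableOn (fun s : ℝ => cexp (-b * s ^ 2) * (3 / (4 * b ^ 2 * s ^ 4))) (Ioi X) := by
    refine Integrable.mono' (hdecay.const_mul (3 / (4 * ‖b‖ ^ 2)))
      (hcont.aestronglyMeasurable measurableSet_Ioi) ?_
    exact (ae_restrict_iff' measurableSet_Ioi).2 (Eventually.of_forall hbound)
  have hlim : Tendsto (fun s : ℝ => cexp (-b * s ^ 2) * (-1 / (2 * b * s) + 1 / (4 * b ^ 2 * s ^ 3)))
      atTop (𝓝 0) := by
    have h1 : Tendsto (fun s : ℝ => -1 / (2 * b * s) + 1 / (4 * b ^ 2 * s ^ 3)) atTop (𝓝 0) := by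
      have hi : Tendsto (fun s : ℝ => ((s : ℂ))⁻¹) atTop (𝓝 0) :=
        tendsto_inv₀_cobounded.comp (RCLike.tendsto_ofReal_atTop_cobounded ℂ)
      have := (hi.const_mul (-1 / (2 * b))).add ((hi.pow 3).const_mul (1 / (4 * b ^ 2)))
      simp only [mul_zero, ne_eq, OfNat.ofNat_ne_zero, not_false_eq_true, zero_pow, add_zero] at this
      refine this.congr fun s => ?_
      rw [inv_pow]
      simp only [div_eq_mul_inv, mul_inv]
      ring
    refine squeeze_zero_norm (fun s => ?_) (h1.norm.trans (by simp))
    rw [norm_mul]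
    exact mul_le_of_le_one_left (norm_nonneg _) (norm_gaussian_le_one hb s)
  have hFTC := integral_Ioi_of_hasDerivAt_of_tendsto' (a := X)
    (fun s hs => hasDerivAt_gaussian_tail_primitive hb0 (hX.trans_le hs)) (hint.sub hint2) hlim
  rw [integral_sub hint hint2] at hFTC
  have hval : ∫ s in Ioi X, 3 / (4 * ‖b‖ ^ 2) * s ^ (-4 : ℝ) = 1 / (4 * ‖b‖ ^ 2 * X ^ 3) := by
    rw [integral_const_mul, integral_Ioi_rpow_of_lt (by norm_num) hX]
    have : X ^ (-4 + 1 : ℝ) = (X ^ 3)⁻¹ := by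
      rw [show (-4 + 1 : ℝ) = -(3 : ℝ) by norm_num, Real.rpow_neg hX.le]
      congr 1
      exact_mod_cast Real.rpow_natCast X 3
    rw [this]
    have : ‖b‖ ≠ 0 := norm_ne_zero_iff.2 hb0
    field_simp
    norm_num
  have hrem : ‖∫ s in Ioi X, cexp (-b * s ^ 2) * (3 / (4 * b ^ 2 * s ^ 4))‖
      ≤ 1 / (4 * ‖b‖ ^ 2 * X ^ 3) := by
    rw [← hval]
    exact norm_integral_le_of_norm_le (hdecay.const_mul _)
      ((ae_restrict_iff' measurableSet_Ioi).2 (Eventually.of_forall hbound))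
  have hX' : (X : ℂ) ≠ 0 := by exact_mod_cast hX.ne'
  have heq : (∫ s in Ioi X, cexp (-b * s ^ 2)) - cexp (-b * X ^ 2) / (2 * b * X)
      = (∫ s in Ioi X, cexp (-b * s ^ 2) * (3 / (4 * b ^ 2 * s ^ 4)))
        - cexp (-b * X ^ 2) * (1 / (4 * b ^ 2 * X ^ 3)) := by
    rw [sub_eq_iff_eq_add] at hFTC
    rw [hFTC]
    generalize ∫ s in Ioi X, cexp (-b * s ^ 2) * (3 / (4 * b ^ 2 * s ^ 4)) = R
    field_simp
    ring
  rw [heq]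
  have hbd : ‖cexp (-b * X ^ 2) * (1 / (4 * b ^ 2 * X ^ 3))‖ ≤ 1 / (4 * ‖b‖ ^ 2 * X ^ 3) := by
    rw [norm_mul]
    refine (mul_le_of_le_one_left (norm_nonneg _) (norm_gaussian_le_one hb X)).trans (le_of_eq ?_)
    simp [abs_of_pos hX]
  refine (norm_sub_le _ _).trans ((add_le_add hrem hbd).trans ?_)
  have : 0 < ‖b‖ := norm_pos_iff.2 hb0
  rw [← add_div, div_le_div_iff₀ (by positivity) (by positivity)]
  nlinarith [show 0 < ‖b‖ ^ 2 * X ^ 3 by positivity]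

/-- The incomplete Fresnel integral, with its first two asymptotic terms. -/
lemma norm_fresnel_sub_le {X : ℝ} (hX : 0 < X) :
    ‖(∫ s in (0 : ℝ)..X, cexp (Real.pi * I * s ^ 2)) -
      (cexp (Real.pi * I / 4) / 2 + cexp (Real.pi * I * X ^ 2) / (2 * Real.pi * I * X))‖
      ≤ 1 / X ^ 3 := by
  have hpi : (Real.pi : ℂ) ≠ 0 := by exact_mod_cast Real.pi_ne_zero
  let b : ℝ → ℂ := fun ε => ε - Real.pi * I
  have hbc : Continuous b := by fun_prop
  have hb0 : b 0 = -(Real.pi * I) := by simp [b]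
  have hre : ∀ ε, (b ε).re = ε := by intro ε; simp [b]
  have him : ∀ ε, (b ε).im = -Real.pi := by intro ε; simp [b]
  have hbn : ∀ ε, 1 ≤ ‖b ε‖ := by
    intro ε
    have := Complex.abs_im_le_norm (b ε)
    rw [him, abs_neg, abs_of_pos Real.pi_pos] at this
    linarith [Real.pi_gt_three]
  have hbne : ∀ ε, b ε ≠ 0 := fun ε => norm_pos_iff.1 (zero_lt_one.trans_le (hbn ε))
  have hX' : (X : ℂ) ≠ 0 := by exact_mod_cast hX.ne'
  have key : ∀ ε > 0, ‖(∫ s in (0 : ℝ)..X, cexp (-(b ε) * s ^ 2)) -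
      ((Real.pi / b ε) ^ (1 / 2 : ℂ) / 2 - cexp (-(b ε) * X ^ 2) / (2 * b ε * X))‖
      ≤ 1 / X ^ 3 := by
    intro ε hε
    have hbre : 0 < (b ε).re := by rw [hre]; exact hε
    have htail := norm_gaussian_tail_le hbre hX
    have hint := integrable_cexp_neg_mul_sq hbre
    have h1 : (∫ s in (0 : ℝ)..X, cexp (-(b ε) * s ^ 2)) + ∫ s in Ioi X, cexp (-(b ε) * s ^ 2)
        = (Real.pi / b ε) ^ (1 / 2 : ℂ) / 2 := by
      rw [intervalIntegral.integral_interval_add_Ioi hint.integrableOn hint.integrableOn,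
        integral_gaussian_complex_Ioi hbre]
    rw [← h1]
    have : ∀ u v w : ℂ, u - (u + v - w) = -(v - w) := by intros; ring
    rw [this, norm_neg]
    refine htail.trans ?_
    have := hbn ε
    have : 1 ≤ ‖b ε‖ ^ 2 := one_le_pow₀ this
    gcongr
    nlinarith [pow_pos hX 3]
  have hc : ContinuousAt (fun ε => (∫ s in (0 : ℝ)..X, cexp (-(b ε) * s ^ 2)) -
      ((Real.pi / b ε) ^ (1 / 2 : ℂ) / 2 - cexp (-(b ε) * X ^ 2) / (2 * b ε * X))) 0 := by
    refine ContinuousAt.sub ?_ (ContinuousAt.sub ?_ ?_)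
    · refine Continuous.continuousAt ?_
      apply intervalIntegral.continuous_parametric_intervalIntegral_of_continuous'
      fun_prop
    · refine ContinuousAt.div_const ?_ _
      refine ContinuousAt.cpow (continuousAt_const.div hbc.continuousAt (hbne 0))
        continuousAt_const ?_
      rw [hb0]
      have : (Real.pi : ℂ) / -(Real.pi * I) = I := by
        field_simp
        simp
      rw [this]
      simp [Complex.mem_slitPlane_iff]
    · refine ContinuousAt.div (by fun_prop) (by fun_prop) ?_
      simp [hbne 0, hX']
  have hlim := le_of_tendsto ((hc.tendsto.norm).mono_left (nhdsWithin_le_nhds (s := Ioi 0)))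
    (eventually_nhdsWithin_of_forall fun ε hε => key ε hε)
  have e1 : ((Real.pi : ℂ) / -(Real.pi * I)) ^ (1 / 2 : ℂ) = cexp (Real.pi * I / 4) := by
    have : (Real.pi : ℂ) / -(Real.pi * I) = I := by
      field_simp
      simp
    rw [this, Complex.cpow_def_of_ne_zero I_ne_zero, Complex.log_I]
    congr 1
    ring
  simp only [hb0, neg_neg, e1] at hlim
  refine le_of_eq_of_le (congrArg norm ?_) hlim
  congr 1
  generalize cexp (Real.pi * I * X ^ 2) = E
  field_simp
  ring

lemma norm_ee (x : ℝ) : ‖ee x‖ = 1 := by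
  have : (2 * Real.pi * I * x : ℂ) = ((2 * Real.pi * x : ℝ) : ℂ) * I := by push_cast; ring
  rw [ee, this, Complex.norm_exp_ofReal_mul_I]

lemma ee_add (x y : ℝ) : ee (x + y) = ee x * ee y := by
  rw [ee, ee, ee, ← Complex.exp_add]
  push_cast
  ring_nf

lemma ee_zero : ee 0 = 1 := by simp [ee]

lemma continuous_ee : Continuous ee := by
  unfold ee
  fun_prop

lemma hasDerivWithinAt_ee {φ : ℝ → ℝ} {φ' x : ℝ} {s : Set ℝ} (T : ℝ)
    (hφ : HasDerivWithinAt φ φ' s x) :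
    HasDerivWithinAt (fun x => ee (T * φ x)) (2 * Real.pi * I * T * φ' * ee (T * φ x)) s x := by
  have h1 := ((hφ.const_mul T).ofReal_comp.const_mul (2 * Real.pi * I : ℂ)).cexp
  refine h1.congr_deriv ?_
  rw [ee]
  push_cast
  ring

lemma integral_Icc_eq_sub_of_hasDerivWithinAt {F F' : ℝ → ℂ} {a b l r : ℝ} (hab : a ≤ b)
    (hl : l ≤ a) (hr : b ≤ r)
    (hF : ∀ x ∈ Icc a b, HasDerivWithinAt F (F' x) (Icc l r) x)
    (hF' : ContinuousOn F' (Icc a b)) : ∫ x in a..b, F' x = F b - F a := by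
  refine intervalIntegral.integral_eq_sub_of_hasDerivAt_of_le hab ?_ ?_
    (hF'.intervalIntegrable_of_Icc hab)
  · exact fun x hx => (hF x hx).continuousWithinAt.mono (Icc_subset_Icc hl hr)
  · intro x hx
    exact (hF x (Ioo_subset_Icc_self hx)).hasDerivAt
      (Icc_mem_nhds (hl.trans_lt hx.1) (hx.2.trans_le hr))

/-- A phase on `[0, h]` with a stationary point at `0`, normalised to unit size, with its
derivatives up to order four and uniform bounds for them. -/
structure NormalizedPhase (A h : ℝ) (φ φ₁ φ₂ φ₃ φ₄ : ℝ → ℝ) : Prop where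
  one_le : 1 ≤ A
  pos : 0 < h
  deriv₀ : ∀ x ∈ Icc 0 h, HasDerivWithinAt φ (φ₁ x) (Icc 0 h) x
  deriv₁ : ∀ x ∈ Icc 0 h, HasDerivWithinAt φ₁ (φ₂ x) (Icc 0 h) x
  deriv₂ : ∀ x ∈ Icc 0 h, HasDerivWithinAt φ₂ (φ₃ x) (Icc 0 h) x
  deriv₃ : ∀ x ∈ Icc 0 h, HasDerivWithinAt φ₃ (φ₄ x) (Icc 0 h) x
  cont₄ : ContinuousOn φ₄ (Icc 0 h)
  zero₀ : φ 0 = 0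
  zero₁ : φ₁ 0 = 0
  lower₂ : ∀ x ∈ Icc 0 h, 1 ≤ A * φ₂ x
  upper₂ : ∀ x ∈ Icc 0 h, |φ₂ x| ≤ A
  upper₃ : ∀ x ∈ Icc 0 h, |φ₃ x| ≤ A
  upper₄ : ∀ x ∈ Icc 0 h, |φ₄ x| ≤ A

namespace NormalizedPhase

variable {A h : ℝ} {φ φ₁ φ₂ φ₃ φ₄ : ℝ → ℝ}

lemma upper₁ (H : NormalizedPhase A h φ φ₁ φ₂ φ₃ φ₄) : ∀ x ∈ Icc 0 h, |φ₁ x| ≤ A * x := by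
  have hA := H.one_le
  simpa using abs_le_pow_of_deriv_le (m := 0) (by linarith) H.deriv₁ H.zero₁
    (by simpa using H.upper₂)

lemma upper₀ (H : NormalizedPhase A h φ φ₁ φ₂ φ₃ φ₄) : ∀ x ∈ Icc 0 h, |φ x| ≤ A * x ^ 2 := by
  have hA := H.one_le
  exact abs_le_pow_of_deriv_le (m := 1) (by linarith) H.deriv₀ H.zero₀
    (by simpa using H.upper₁)

lemma lower₁ (H : NormalizedPhase A h φ φ₁ φ₂ φ₃ φ₄) : ∀ x ∈ Icc 0 h, x ≤ A * φ₁ x :=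
  le_of_le_deriv (fun x _ => hasDerivWithinAt_id x _)
    (fun x hx => (H.deriv₁ x hx).const_mul A) (by simp [H.zero₁]) H.lower₂

lemma lower₀ (H : NormalizedPhase A h φ φ₁ φ₂ φ₃ φ₄) :
    ∀ x ∈ Icc 0 h, x ^ 2 ≤ A * (2 * φ x) := by
  refine le_of_le_deriv (F' := fun x => 2 * x) (G' := fun x => A * (2 * φ₁ x)) (fun x _ => ?_)
    (fun x hx => ((H.deriv₀ x hx).const_mul 2).const_mul A) (by simp [H.zero₀]) ?_
  · simpa using (hasDerivAt_pow 2 x).hasDerivWithinAt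
  · intro x hx
    linarith [H.lower₁ x hx]

/-- `2 φ φ₂ - φ₁ ^ 2` vanishes to third order at `0`. -/
lemma abs_two_mul_mul_sub_sq_le (H : NormalizedPhase A h φ φ₁ φ₂ φ₃ φ₄) :
    ∀ x ∈ Icc 0 h, |2 * φ x * φ₂ x - φ₁ x ^ 2| ≤ 2 * A ^ 2 * x ^ 3 := by
  have hA := H.one_le
  refine abs_le_pow_of_deriv_le (m := 2) (F' := fun x => 2 * φ x * φ₃ x) (by positivity) ?_
    (by simp [H.zero₀, H.zero₁]) ?_
  · intro x hx
    refine ((((H.deriv₀ x hx).const_mul 2).mul (H.deriv₂ x hx)).sub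
      ((H.deriv₁ x hx).pow 2)).congr_deriv ?_
    push_cast
    ring
  · intro x hx
    rw [abs_mul, abs_mul, abs_two]
    have h0 := H.upper₀ x hx
    have h3 := H.upper₃ x hx
    calc 2 * |φ x| * |φ₃ x| ≤ 2 * (A * x ^ 2) * A := by gcongr
      _ = _ := by ring

lemma abs_auxiliary_cubic_le (H : NormalizedPhase A h φ φ₁ φ₂ φ₃ φ₄) :
    ∀ x ∈ Icc 0 h, |2 * φ x * φ₁ x * φ₃ x - 3 * φ₂ x * (2 * φ x * φ₂ x - φ₁ x ^ 2)|
      ≤ 12 * A ^ 3 * x ^ 4 := by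
  have hA := H.one_le
  refine abs_le_pow_of_deriv_le (m := 3)
    (F' := fun x => 2 * φ x * φ₁ x * φ₄ x - 5 * φ₃ x * (2 * φ x * φ₂ x - φ₁ x ^ 2))
    (by positivity) ?_ (by simp [H.zero₀, H.zero₁]) ?_
  · intro x hx
    refine (((((H.deriv₀ x hx).const_mul 2).mul (H.deriv₁ x hx)).mul (H.deriv₃ x hx)).sub
      (((H.deriv₂ x hx).const_mul 3).mul ((((H.deriv₀ x hx).const_mul 2).mul (H.deriv₂ x hx)).sub
      ((H.deriv₁ x hx).pow 2)))).congr_deriv ?_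
    simp only [Pi.mul_apply, Pi.sub_apply, Pi.pow_apply]
    push_cast
    ring
  · intro x hx
    have h0 := H.upper₀ x hx
    have h1 := H.upper₁ x hx
    have h3 := H.upper₃ x hx
    have h4 := H.upper₄ x hx
    have hW := H.abs_two_mul_mul_sub_sq_le x hx
    have hx0 := hx.1
    refine (abs_sub _ _).trans ?_
    simp only [abs_mul, abs_two, abs_of_pos (show (0 : ℝ) < 5 by norm_num)]
    calc 2 * |φ x| * |φ₁ x| * |φ₄ x| + 5 * |φ₃ x| * |2 * φ x * φ₂ x - φ₁ x ^ 2|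
        ≤ 2 * (A * x ^ 2) * (A * x) * A + 5 * A * (2 * A ^ 2 * x ^ 3) := by gcongr
      _ = _ := by ring

lemma abs_auxiliary_quintic_le (H : NormalizedPhase A h φ φ₁ φ₂ φ₃ φ₄) :
    ∀ x ∈ Icc 0 h, |(2 * φ x) ^ 2 * φ₃ x - 3 * φ₁ x * (2 * φ x * φ₂ x - φ₁ x ^ 2)|
      ≤ 16 * A ^ 3 * x ^ 5 := by
  have hA := H.one_le
  refine abs_le_pow_of_deriv_le (m := 4)
    (F' := fun x => 2 * φ x * φ₁ x * φ₃ x - 3 * φ₂ x * (2 * φ x * φ₂ x - φ₁ x ^ 2)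
      + (2 * φ x) ^ 2 * φ₄ x)
    (by positivity) ?_ (by simp [H.zero₀, H.zero₁]) ?_
  · intro x hx
    refine (((((H.deriv₀ x hx).const_mul 2).pow 2).mul (H.deriv₃ x hx)).sub
      (((H.deriv₁ x hx).const_mul 3).mul ((((H.deriv₀ x hx).const_mul 2).mul (H.deriv₂ x hx)).sub
      ((H.deriv₁ x hx).pow 2)))).congr_deriv ?_
    simp only [Pi.mul_apply, Pi.sub_apply, Pi.pow_apply]
    push_cast
    ring
  · intro x hx
    have h0 := H.upper₀ x hx
    have h4 := H.upper₄ x hx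
    have hS := H.abs_auxiliary_cubic_le x hx
    have hx0 := hx.1
    refine (abs_add_le _ _).trans ?_
    have : |(2 * φ x) ^ 2 * φ₄ x| ≤ 4 * A ^ 3 * x ^ 4 := by
      simp only [abs_mul, abs_two, abs_pow]
      calc (2 * |φ x|) ^ 2 * |φ₄ x| ≤ (2 * (A * x ^ 2)) ^ 2 * A := by gcongr
        _ = _ := by ring
    linarith

/-- `φ₁(x) = φ₂(0) x + O(x ^ 2)`. -/
lemma abs_deriv_sub_linear_le (H : NormalizedPhase A h φ φ₁ φ₂ φ₃ φ₄) :
    ∀ x ∈ Icc 0 h, |φ₁ x - φ₂ 0 * x| ≤ A * x ^ 2 := by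
  have hA := H.one_le
  refine abs_le_pow_of_deriv_le (m := 1) (F' := fun x => φ₂ x - φ₂ 0) (by positivity) ?_
    (by simp [H.zero₁]) ?_
  · intro x hx
    exact ((H.deriv₁ x hx).sub ((hasDerivWithinAt_id x _).const_mul (φ₂ 0))).congr_deriv (by simp)
  · refine abs_le_pow_of_deriv_le (m := 0) (F' := φ₃) (by positivity) ?_ (by simp) ?_
    · intro x hx
      exact (H.deriv₂ x hx).sub_const _
    · simpa using H.upper₃

/-- `φ₂(x) = φ₂(0) + φ₃(0) x + O(x ^ 2)`. -/
lemma abs_deriv₂_sub_linear_le (H : NormalizedPhase A h φ φ₁ φ₂ φ₃ φ₄) :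
    ∀ x ∈ Icc 0 h, |φ₂ x - φ₂ 0 - φ₃ 0 * x| ≤ A * x ^ 2 := by
  have hA := H.one_le
  refine abs_le_pow_of_deriv_le (m := 1) (F' := fun x => φ₃ x - φ₃ 0) (by positivity) ?_
    (by simp) ?_
  · intro x hx
    exact (((H.deriv₂ x hx).sub_const (φ₂ 0)).sub
      ((hasDerivWithinAt_id x _).const_mul (φ₃ 0))).congr_deriv (by simp)
  · refine abs_le_pow_of_deriv_le (m := 0) (F' := φ₄) (by positivity) ?_ (by simp) ?_
    · intro x hx
      exact (H.deriv₃ x hx).sub_const _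
    · simpa using H.upper₄

/-- `x φ₁(x) - 2 φ(x) = O(x ^ 3)`. -/
lemma abs_mul_deriv_sub_le (H : NormalizedPhase A h φ φ₁ φ₂ φ₃ φ₄) :
    ∀ x ∈ Icc 0 h, |x * φ₁ x - 2 * φ x| ≤ A * x ^ 3 := by
  have hA := H.one_le
  refine abs_le_pow_of_deriv_le (m := 2) (F' := fun x => x * φ₂ x - φ₁ x) (by positivity) ?_
    (by simp [H.zero₀]) ?_
  · intro x hx
    refine (((hasDerivWithinAt_id x _).mul (H.deriv₁ x hx)).sub
      ((H.deriv₀ x hx).const_mul 2)).congr_deriv ?_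
    simp only [id]
    ring
  · refine abs_le_pow_of_deriv_le (m := 1) (F' := fun x => x * φ₃ x) (by positivity) ?_
      (by simp [H.zero₁]) ?_
    · intro x hx
      refine (((hasDerivWithinAt_id x _).mul (H.deriv₂ x hx)).sub (H.deriv₁ x hx)).congr_deriv ?_
      simp only [id]
      ring
    · intro x hx
      rw [abs_mul, abs_of_nonneg hx.1, pow_one, mul_comm]
      have := hx.1
      gcongr
      exact H.upper₃ x hx

/-- `φ₁ ^ 2 = 2 φ₂(0) φ + O(x ^ 3)`. -/
lemma abs_sq_deriv_sub_le (H : NormalizedPhase A h φ φ₁ φ₂ φ₃ φ₄) :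
    ∀ x ∈ Icc 0 h, |φ₁ x ^ 2 - φ₂ 0 * (2 * φ x)| ≤ 2 * A ^ 2 * x ^ 3 := by
  have hA := H.one_le
  refine abs_le_pow_of_deriv_le (m := 2) (F' := fun x => 2 * φ₁ x * (φ₂ x - φ₂ 0))
    (by positivity) ?_ (by simp [H.zero₀, H.zero₁]) ?_
  · intro x hx
    refine (((H.deriv₁ x hx).pow 2).sub (((H.deriv₀ x hx).const_mul 2).const_mul
      (φ₂ 0))).congr_deriv ?_
    push_cast
    ring
  · have h2 : ∀ x ∈ Icc 0 h, |φ₂ x - φ₂ 0| ≤ A * x ^ 1 := by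
      refine abs_le_pow_of_deriv_le (m := 0) (F' := φ₃) (by positivity) ?_ (by simp) ?_
      · intro x hx
        exact (H.deriv₂ x hx).sub_const _
      · simpa using H.upper₃
    intro x hx
    have h1 := H.upper₁ x hx
    have h2 := h2 x hx
    have := hx.1
    rw [abs_mul, abs_mul, abs_two]
    calc 2 * |φ₁ x| * |φ₂ x - φ₂ 0| ≤ 2 * (A * x) * (A * x ^ 1) := by gcongr
      _ = _ := by ring

/-- The expansion of `φ₁ ^ 2 - 2 φ₂(0) φ` to order three. -/
lemma abs_sq_deriv_sub_sub_le (H : NormalizedPhase A h φ φ₁ φ₂ φ₃ φ₄) :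
    ∀ x ∈ Icc 0 h, |φ₁ x ^ 2 - φ₂ 0 * (2 * φ x) - 2 * φ₃ 0 / 3 * x * (2 * φ x)|
      ≤ 3 * A ^ 2 * x ^ 4 := by
  have hA := H.one_le
  refine abs_le_pow_of_deriv_le (m := 3)
    (F' := fun x => 2 * φ₁ x * (φ₂ x - φ₂ 0 - φ₃ 0 * x)
      + 2 * φ₃ 0 / 3 * (x * φ₁ x - 2 * φ x))
    (by positivity) ?_ (by simp [H.zero₀, H.zero₁]) ?_
  · intro x hx
    refine ((((H.deriv₁ x hx).pow 2).sub (((H.deriv₀ x hx).const_mul 2).const_mul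
      (φ₂ 0))).sub (((hasDerivWithinAt_id x _).const_mul (2 * φ₃ 0 / 3)).mul
        ((H.deriv₀ x hx).const_mul 2))).congr_deriv ?_
    simp only [id]
    push_cast
    ring
  · intro x hx
    have h1 := H.upper₁ x hx
    have h2 := H.abs_deriv₂_sub_linear_le x hx
    have h3 := H.upper₃ 0 ⟨le_rfl, H.pos.le⟩
    have h4 := H.abs_mul_deriv_sub_le x hx
    have := hx.1
    refine (abs_add_le _ _).trans ?_
    simp only [abs_mul, abs_div, abs_two, abs_of_pos (show (0 : ℝ) < 3 by norm_num)]
    calc 2 * |φ₁ x| * |φ₂ x - φ₂ 0 - φ₃ 0 * x| + 2 * |φ₃ 0| / 3 * |x * φ₁ x - 2 * φ x|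
        ≤ 2 * (A * x) * (A * x ^ 2) + 2 * A / 3 * (A * x ^ 3) := by gcongr
      _ ≤ _ := by nlinarith [show 0 ≤ A ^ 2 * x ^ 3 by positivity]

lemma sqrt_pos (H : NormalizedPhase A h φ φ₁ φ₂ φ₃ φ₄) {x : ℝ} (hx : x ∈ Ioc 0 h) :
    0 < √(2 * φ x) := by
  have hA := H.one_le
  have := H.lower₀ x (Ioc_subset_Icc_self hx)
  have := pow_pos hx.1 2
  exact Real.sqrt_pos.2 (by by_contra! hc; nlinarith)

lemma sq_sqrt (H : NormalizedPhase A h φ φ₁ φ₂ φ₃ φ₄) {x : ℝ} (hx : x ∈ Ioc 0 h) :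
    √(2 * φ x) ^ 2 = 2 * φ x :=
  Real.sq_sqrt (Real.sqrt_pos.1 (H.sqrt_pos hx)).le

lemma le_mul_sqrt (H : NormalizedPhase A h φ φ₁ φ₂ φ₃ φ₄) {x : ℝ} (hx : x ∈ Ioc 0 h) :
    x ≤ A * √(2 * φ x) := by
  have hA := H.one_le
  have h1 := H.lower₀ x (Ioc_subset_Icc_self hx)
  rw [← H.sq_sqrt hx] at h1
  have h2 := H.sqrt_pos hx
  refine le_of_sq_le_sq (h1.trans ?_) (by positivity)
  rw [mul_pow]
  gcongr
  nlinarith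

lemma curvature_pos (H : NormalizedPhase A h φ φ₁ φ₂ φ₃ φ₄) : 0 < φ₂ 0 := by
  have hA := H.one_le
  have := H.lower₂ 0 ⟨le_rfl, H.pos.le⟩
  by_contra! hc
  nlinarith

lemma one_le_mul_sqrt (H : NormalizedPhase A h φ φ₁ φ₂ φ₃ φ₄) : 1 ≤ A * √(φ₂ 0) := by
  have hA := H.one_le
  have h1 := H.lower₂ 0 ⟨le_rfl, H.pos.le⟩
  have h2 := H.curvature_pos
  rw [← Real.sq_sqrt h2.le] at h1
  have h3 := Real.sqrt_pos.2 h2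
  refine le_of_sq_le_sq ?_ (by positivity)
  rw [mul_pow, one_pow]
  refine h1.trans ?_
  gcongr
  nlinarith

lemma hasDerivWithinAt_sqrt (H : NormalizedPhase A h φ φ₁ φ₂ φ₃ φ₄) {x : ℝ} (hx : x ∈ Ioc 0 h) :
    HasDerivWithinAt (fun x => √(2 * φ x)) (φ₁ x / √(2 * φ x)) (Icc 0 h) x := by
  refine (((H.deriv₀ x (Ioc_subset_Icc_self hx)).const_mul 2).sqrt
    (Real.sqrt_pos.1 (H.sqrt_pos hx)).ne').congr_deriv ?_
  have := H.sqrt_pos hx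
  field_simp

/-- The normalised density `√(2 φ)' / √φ₂(0)` of the substitution `u = √(2 φ)`, which is twice
differentiable up to the stationary point. -/
lemma exists_density (H : NormalizedPhase A h φ φ₁ φ₂ φ₃ φ₄) :
    ∃ q q₁ q₂ : ℝ → ℝ, q 0 = 1 ∧
      (∀ x ∈ Ioc 0 h, q x = φ₁ x / (√(φ₂ 0) * √(2 * φ x))) ∧
      (∀ x ∈ Ioc 0 h, HasDerivWithinAt q (q₁ x) (Icc 0 h) x) ∧
      (∀ x ∈ Ioc 0 h, HasDerivWithinAt q₁ (q₂ x) (Icc 0 h) x) ∧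
      ContinuousOn q₂ (Ioc 0 h) ∧
      (∀ x ∈ Ioc 0 h, |q x - 1| ≤ 2 * A ^ 4 * x) ∧
      (∀ x ∈ Ioc 0 h, |q x - 1 - φ₃ 0 / (3 * φ₂ 0) * x| ≤ 4 * A ^ 8 * x ^ 2) ∧
      (∀ x ∈ Ioc 0 h, |q₁ x| ≤ 2 * A ^ 6) ∧
      (∀ x ∈ Ioc 0 h, |q₂ x| ≤ 16 * A ^ 9) := by
  have hA := H.one_le
  have hl0 := H.curvature_pos
  have hl : 0 < √(φ₂ 0) := Real.sqrt_pos.2 hl0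
  have hAl := H.one_le_mul_sqrt
  have hl2 := Real.sq_sqrt hl0.le
  have hsub : Ioc 0 h ⊆ Icc 0 h := Ioc_subset_Icc_self
  refine ⟨fun x => if x = 0 then 1 else φ₁ x / (√(φ₂ 0) * √(2 * φ x)),
    fun x => (2 * φ x * φ₂ x - φ₁ x ^ 2) / (√(φ₂ 0) * √(2 * φ x) ^ 3),
    fun x => ((2 * φ x) ^ 2 * φ₃ x - 3 * φ₁ x * (2 * φ x * φ₂ x - φ₁ x ^ 2)) /
      (√(φ₂ 0) * √(2 * φ x) ^ 5), if_pos rfl, fun x hx => if_neg hx.1.ne', ?_, ?_, ?_, ?_⟩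
  · intro x hx
    have hs := H.sqrt_pos hx
    have hs2 := H.sq_sqrt hx
    have h1 : HasDerivWithinAt (fun x => φ₁ x / (√(φ₂ 0) * √(2 * φ x)))
        ((2 * φ x * φ₂ x - φ₁ x ^ 2) / (√(φ₂ 0) * √(2 * φ x) ^ 3)) (Icc 0 h) x := by
      refine ((H.deriv₁ x (hsub hx)).div ((H.hasDerivWithinAt_sqrt hx).const_mul _)
        (by positivity)).congr_deriv ?_
      have h2 : φ x = √(2 * φ x) ^ 2 / 2 := by linarith
      generalize √(2 * φ x) = s at *
      rw [h2]
      field_simp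
    refine h1.congr_of_eventuallyEq ?_ (if_neg hx.1.ne')
    filter_upwards [nhdsWithin_le_nhds (Ioi_mem_nhds hx.1)] with y hy
    exact if_neg (ne_of_gt hy)
  · intro x hx
    have hs := H.sqrt_pos hx
    have hs2 := H.sq_sqrt hx
    refine (((((H.deriv₀ x (hsub hx)).const_mul 2).mul (H.deriv₂ x (hsub hx))).sub
      ((H.deriv₁ x (hsub hx)).pow 2)).div (((H.hasDerivWithinAt_sqrt hx).pow 3).const_mul _)
        (by simp only [Pi.pow_apply]; positivity)).congr_deriv ?_
    simp only [Pi.mul_apply, Pi.sub_apply, Pi.pow_apply]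
    have h2 : φ x = √(2 * φ x) ^ 2 / 2 := by linarith
    generalize √(2 * φ x) = s at *
    rw [h2]
    push_cast
    field_simp
    ring
  · have c0 : ContinuousOn φ (Ioc 0 h) := fun x hx =>
      (H.deriv₀ x (hsub hx)).continuousWithinAt.mono hsub
    have c1 : ContinuousOn φ₁ (Ioc 0 h) := fun x hx =>
      (H.deriv₁ x (hsub hx)).continuousWithinAt.mono hsub
    have c2 : ContinuousOn φ₂ (Ioc 0 h) := fun x hx =>
      (H.deriv₂ x (hsub hx)).continuousWithinAt.mono hsub
    have c3 : ContinuousOn φ₃ (Ioc 0 h) := fun x hx =>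
      (H.deriv₃ x (hsub hx)).continuousWithinAt.mono hsub
    refine ContinuousOn.div (by fun_prop) (by fun_prop) ?_
    intro x hx
    have := H.sqrt_pos hx
    positivity
  · have hq : ∀ x ∈ Ioc 0 h, 0 ≤ φ₁ x / (√(φ₂ 0) * √(2 * φ x)) := by
      intro x hx
      have h1 := H.lower₁ x (hsub hx)
      have : 0 ≤ φ₁ x := by
        by_contra! hc
        nlinarith [hx.1]
      positivity
    have hsq : ∀ x ∈ Ioc 0 h, (φ₁ x / (√(φ₂ 0) * √(2 * φ x))) ^ 2 - 1 =
        (φ₁ x ^ 2 - φ₂ 0 * (2 * φ x)) / (φ₂ 0 * (2 * φ x)) := by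
      intro x hx
      have := Real.sqrt_pos.1 (H.sqrt_pos hx)
      rw [div_pow, mul_pow, H.sq_sqrt hx, hl2, sub_div, div_self (by positivity)]
    have hden : ∀ x ∈ Ioc 0 h, x ^ 2 ≤ A ^ 2 * (φ₂ 0 * (2 * φ x)) := by
      intro x hx
      have h1 := H.lower₀ x (hsub hx)
      have h2 := H.lower₂ 0 ⟨le_rfl, H.pos.le⟩
      have := Real.sqrt_pos.1 (H.sqrt_pos hx)
      calc x ^ 2 ≤ 1 * (A * (2 * φ x)) := by rw [one_mul]; exact h1
        _ ≤ (A * φ₂ 0) * (A * (2 * φ x)) := by gcongr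
        _ = _ := by ring
    have hsq1 : ∀ x ∈ Ioc 0 h, |(φ₁ x / (√(φ₂ 0) * √(2 * φ x))) ^ 2 - 1| ≤ 2 * A ^ 4 * x := by
      intro x hx
      have := Real.sqrt_pos.1 (H.sqrt_pos hx)
      have hp : 0 < φ₂ 0 * (2 * φ x) := by positivity
      rw [hsq x hx, abs_div, abs_of_pos hp, div_le_iff₀ hp]
      refine (H.abs_sq_deriv_sub_le x (hsub hx)).trans ?_
      have := hden x hx
      have := hx.1
      calc 2 * A ^ 2 * x ^ 3 = 2 * A ^ 2 * x * x ^ 2 := by ring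
        _ ≤ 2 * A ^ 2 * x * (A ^ 2 * (φ₂ 0 * (2 * φ x))) := by gcongr
        _ = _ := by ring
    have hsq2 : ∀ x ∈ Ioc 0 h, |(φ₁ x / (√(φ₂ 0) * √(2 * φ x))) ^ 2 - 1
        - 2 * (φ₃ 0 / (3 * φ₂ 0)) * x| ≤ 3 * A ^ 4 * x ^ 2 := by
      intro x hx
      have hφ := Real.sqrt_pos.1 (H.sqrt_pos hx)
      have hp : 0 < φ₂ 0 * (2 * φ x) := by positivity
      have e : (φ₁ x ^ 2 - φ₂ 0 * (2 * φ x)) / (φ₂ 0 * (2 * φ x)) - 2 * (φ₃ 0 / (3 * φ₂ 0)) * x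
          = (φ₁ x ^ 2 - φ₂ 0 * (2 * φ x) - 2 * φ₃ 0 / 3 * x * (2 * φ x)) /
            (φ₂ 0 * (2 * φ x)) := by
        have : φ x ≠ 0 := by intro h0; simp [h0] at hφ
        field_simp
      rw [hsq x hx, e, abs_div, abs_of_pos hp, div_le_iff₀ hp]
      refine (H.abs_sq_deriv_sub_sub_le x (hsub hx)).trans ?_
      have := hden x hx
      calc 3 * A ^ 2 * x ^ 4 = 3 * A ^ 2 * x ^ 2 * x ^ 2 := by ring
        _ ≤ 3 * A ^ 2 * x ^ 2 * (A ^ 2 * (φ₂ 0 * (2 * φ x))) := by gcongr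
        _ = _ := by ring
    have hone : ∀ x ∈ Ioc 0 h, |φ₁ x / (√(φ₂ 0) * √(2 * φ x)) - 1| ≤ 2 * A ^ 4 * x := by
      intro x hx
      refine le_trans ?_ (hsq1 x hx)
      have h0 := hq x hx
      generalize φ₁ x / (√(φ₂ 0) * √(2 * φ x)) = q at *
      rw [show q ^ 2 - 1 = (q - 1) * (q + 1) by ring, abs_mul]
      exact le_mul_of_one_le_right (abs_nonneg _) ((by linarith : 1 ≤ q + 1).trans (le_abs_self _))
    refine ⟨?_, ?_, ?_, ?_⟩
    · intro x hx
      simpa only [if_neg hx.1.ne'] using hone x hx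
    · intro x hx
      simp only [if_neg hx.1.ne']
      have h1 := hone x hx
      have h2 := hsq2 x hx
      generalize φ₁ x / (√(φ₂ 0) * √(2 * φ x)) = q at *
      generalize φ₃ 0 / (3 * φ₂ 0) = m at *
      have h3 : (q - 1) ^ 2 ≤ (2 * A ^ 4 * x) ^ 2 := sq_le_sq' (neg_le_of_abs_le h1) (le_of_abs_le h1)
      have h4 : A ^ 4 ≤ A ^ 8 := pow_le_pow_right₀ hA (by norm_num)
      rw [abs_le] at h2 ⊢
      constructor <;> nlinarith [sq_nonneg (q - 1), sq_nonneg x]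
    · intro x hx
      have hs := H.sqrt_pos hx
      have hx0 := hx.1
      have hxs := H.le_mul_sqrt hx
      have hp : 0 < √(φ₂ 0) * √(2 * φ x) ^ 3 := by positivity
      rw [abs_div, abs_of_pos hp, div_le_iff₀ hp]
      refine (H.abs_two_mul_mul_sub_sq_le x (hsub hx)).trans ?_
      calc 2 * A ^ 2 * x ^ 3 ≤ 2 * A ^ 2 * (A * √(2 * φ x)) ^ 3 * 1 := by rw [mul_one]; gcongr
        _ ≤ 2 * A ^ 2 * (A * √(2 * φ x)) ^ 3 * (A * √(φ₂ 0)) := by gcongr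
        _ = _ := by ring
    · intro x hx
      have hs := H.sqrt_pos hx
      have hx0 := hx.1
      have hxs := H.le_mul_sqrt hx
      have hp : 0 < √(φ₂ 0) * √(2 * φ x) ^ 5 := by positivity
      rw [abs_div, abs_of_pos hp, div_le_iff₀ hp]
      refine (H.abs_auxiliary_quintic_le x (hsub hx)).trans ?_
      calc 16 * A ^ 3 * x ^ 5 ≤ 16 * A ^ 3 * (A * √(2 * φ x)) ^ 5 * 1 := by rw [mul_one]; gcongr
        _ ≤ 16 * A ^ 3 * (A * √(2 * φ x)) ^ 5 * (A * √(φ₂ 0)) := by gcongr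
        _ = _ := by ring

/-- The stationary phase integral of the density of the substitution `u = √(2 φ)`. -/
lemma norm_integral_density_sub_le (H : NormalizedPhase A h φ φ₁ φ₂ φ₃ φ₄) {q : ℝ → ℝ}
    (hq : ∀ x ∈ Ioc 0 h, q x = φ₁ x / (√(φ₂ 0) * √(2 * φ x)))
    (hqc : ContinuousOn q (Icc 0 h)) {t : ℝ} (ht : 0 < t) :
    ‖(∫ x in (0 : ℝ)..h, (q x : ℂ) * ee (t ^ 2 * φ x)) - (ee (1 / 8) / (2 * t * √(φ₂ 0)) +
      q h * ee (t ^ 2 * φ h) / (2 * Real.pi * I * t ^ 2 * φ₁ h))‖ ≤ A ^ 4 / (t ^ 4 * h ^ 3) := by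
  have hA := H.one_le
  have hh := H.pos
  have hl : 0 < √(φ₂ 0) := Real.sqrt_pos.2 H.curvature_pos
  have hh' : h ∈ Ioc 0 h := ⟨hh, le_rfl⟩
  have hs := H.sqrt_pos hh'
  have hpi : (Real.pi : ℂ) ≠ 0 := by exact_mod_cast Real.pi_ne_zero
  have hlc : ((√(φ₂ 0) : ℝ) : ℂ) ≠ 0 := by exact_mod_cast hl.ne'
  have htc : (t : ℂ) ≠ 0 := by exact_mod_cast ht.ne'
  have hsc : ((√(2 * φ h) : ℝ) : ℂ) ≠ 0 := by exact_mod_cast hs.ne'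
  have hexp : ∀ x ∈ Ioc 0 h, cexp (Real.pi * I * ((t * √(2 * φ x) : ℝ) : ℂ) ^ 2)
      = ee (t ^ 2 * φ x) := by
    intro x hx
    rw [ee]
    congr 1
    have h2 := H.sq_sqrt hx
    rw [← ofReal_pow, mul_pow, h2]
    push_cast
    ring
  let F : ℝ → ℂ := fun X => ∫ s in (0 : ℝ)..X, cexp (Real.pi * I * (s : ℂ) ^ 2)
  have hFc : Continuous fun s : ℝ => cexp (Real.pi * I * (s : ℂ) ^ 2) := by fun_prop
  have hF : ∀ X : ℝ, HasDerivAt F (cexp (Real.pi * I * (X : ℂ) ^ 2)) X := fun X =>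
    intervalIntegral.integral_hasDerivAt_right (hFc.intervalIntegrable _ _)
      (hFc.stronglyMeasurableAtFilter _ _) hFc.continuousAt
  have hφc : ContinuousOn φ (Icc 0 h) := fun x hx => (H.deriv₀ x hx).continuousWithinAt
  have hint : ∫ x in (0 : ℝ)..h, (q x : ℂ) * ee (t ^ 2 * φ x)
      = F (t * √(2 * φ h)) / (t * √(φ₂ 0)) := by
    have := intervalIntegral.integral_eq_sub_of_hasDerivAt_of_le
      (f := fun x => F (t * √(2 * φ x)) / (t * √(φ₂ 0)))
      (f' := fun x => (q x : ℂ) * ee (t ^ 2 * φ x)) hh.le ?_ ?_ ?_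
    · rw [this]
      simp [F, H.zero₀]
    · refine ContinuousOn.div_const ?_ _
      have hFcont : Continuous F := continuous_iff_continuousAt.2 fun X => (hF X).continuousAt
      exact hFcont.comp_continuousOn (by fun_prop)
    · intro x hx
      have hx' := Ioo_subset_Ioc_self hx
      have h1 := (H.hasDerivWithinAt_sqrt hx').hasDerivAt (Icc_mem_nhds hx.1 hx.2)
      have h2 := ((hF (t * √(2 * φ x))).scomp x (h1.const_mul t)).div_const (t * √(φ₂ 0) : ℂ)
      refine h2.congr_deriv ?_
      rw [hexp x hx', hq x hx', real_smul]
      have : ((√(2 * φ x) : ℝ) : ℂ) ≠ 0 := by exact_mod_cast (H.sqrt_pos hx').ne'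
      push_cast
      field_simp
    · refine ContinuousOn.intervalIntegrable_of_Icc hh.le ?_
      refine ContinuousOn.mul (continuous_ofReal.comp_continuousOn hqc)
        (continuous_ee.comp_continuousOn (by fun_prop))
  have hX : 0 < t * √(2 * φ h) := by positivity
  have hfres := norm_fresnel_sub_le hX
  rw [hexp h hh'] at hfres
  have h1h : (φ₁ h : ℂ) ≠ 0 := by
    have := H.lower₁ h ⟨hh.le, le_rfl⟩
    have : φ₁ h ≠ 0 := by intro h0; rw [h0] at this; linarith
    exact_mod_cast this
  have heq : F (t * √(2 * φ h)) / (t * √(φ₂ 0)) - (ee (1 / 8) / (2 * t * √(φ₂ 0)) +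
      q h * ee (t ^ 2 * φ h) / (2 * Real.pi * I * t ^ 2 * φ₁ h)) =
      (F (t * √(2 * φ h)) - (cexp (Real.pi * I / 4) / 2 + ee (t ^ 2 * φ h) /
        (2 * Real.pi * I * ((t * √(2 * φ h) : ℝ) : ℂ)))) / (t * √(φ₂ 0)) := by
    rw [hq h hh', show ee (1 / 8) = cexp (Real.pi * I / 4) by
      rw [ee]; congr 1; push_cast; ring]
    push_cast
    field_simp
  rw [hint, heq, norm_div]
  have hn : ‖(t * √(φ₂ 0) : ℂ)‖ = t * √(φ₂ 0) := by
    rw [← ofReal_mul, Complex.norm_real, Real.norm_of_nonneg (by positivity)]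
  rw [hn, div_le_div_iff₀ (by positivity) (by positivity)]
  have hxs := H.le_mul_sqrt hh'
  have hAl := H.one_le_mul_sqrt
  have hX3 : 1 / (t * √(2 * φ h)) ^ 3 * (t ^ 4 * h ^ 3) ≤ A ^ 3 * t := by
    rw [div_mul_eq_mul_div, div_le_iff₀ (by positivity)]
    calc 1 * (t ^ 4 * h ^ 3) ≤ 1 * (t ^ 4 * (A * √(2 * φ h)) ^ 3) := by gcongr
      _ = _ := by ring
  calc _ ≤ 1 / (t * √(2 * φ h)) ^ 3 * (t ^ 4 * h ^ 3) := by gcongr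
    _ ≤ A ^ 3 * t * 1 := by rw [mul_one]; exact hX3
    _ ≤ A ^ 3 * t * (A * √(φ₂ 0)) := by gcongr
    _ = _ := by ring

lemma norm_integral_inv_sq_le {R : ℝ → ℂ} {C a b : ℝ} (ha : 0 < a) (hab : a ≤ b) (hC : 0 ≤ C)
    (hR : ∀ x ∈ Icc a b, ‖R x‖ ≤ C / x ^ 2) : ‖∫ x in a..b, R x‖ ≤ C / a := by
  have hne : ∀ x ∈ Icc a b, x ≠ 0 := fun x hx => (ha.trans_le hx.1).ne'
  have hcont : ContinuousOn (fun x : ℝ => C / x ^ 2) (Icc a b) :=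
    ContinuousOn.div (by fun_prop) (by fun_prop) fun x hx => pow_ne_zero 2 (hne x hx)
  have hi := hcont.intervalIntegrable_of_Icc (μ := volume) hab
  have hval : ∫ x in a..b, C / x ^ 2 = -C / b - -C / a := by
    refine intervalIntegral.integral_eq_sub_of_hasDerivAt (fun x hx => ?_) hi
    rw [uIcc_of_le hab] at hx
    have := hne x hx
    refine ((hasDerivAt_const x (-C)).div (hasDerivAt_id x) this).congr_deriv ?_
    simp only [id]
    ring
  refine (intervalIntegral.norm_integral_le_of_norm_le hab (ae_of_all _ fun x hx =>
    hR x (Ioc_subset_Icc_self hx)) hi).trans ?_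
  rw [hval]
  have : 0 ≤ C / b := div_nonneg hC (ha.le.trans hab)
  rw [neg_div, neg_div]
  linarith

/-- An oscillatory integral whose amplitude vanishes at the stationary point is given by the
boundary terms of one integration by parts. -/
lemma norm_integral_sub_boundary_le (H : NormalizedPhase A h φ φ₁ φ₂ φ₃ φ₄) {N N₁ N₂ : ℝ → ℂ}
    {k : ℂ} {B t : ℝ} (ht : 0 < t) (hth : 1 ≤ t * h) (hB : 0 ≤ B)
    (hNc : ContinuousOn N (Icc 0 h))
    (hN : ∀ x ∈ Ioc 0 h, HasDerivWithinAt N (N₁ x) (Icc 0 h) x)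
    (hN₁ : ∀ x ∈ Ioc 0 h, HasDerivWithinAt N₁ (N₂ x) (Icc 0 h) x)
    (hN₂c : ContinuousOn N₂ (Ioc 0 h))
    (hN0b : ∀ x ∈ Ioc 0 h, ‖N x‖ ≤ B * x)
    (hNkb : ∀ x ∈ Ioc 0 h, ‖N x - k * φ₁ x‖ ≤ B * x ^ 2)
    (hN₁b : ∀ x ∈ Ioc 0 h, ‖N₁ x‖ ≤ B)
    (hN₂b : ∀ x ∈ Ioc 0 h, ‖N₂ x‖ ≤ B) :
    ‖(∫ x in (0 : ℝ)..h, N x * ee (t ^ 2 * φ x)) -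
      (N h * ee (t ^ 2 * φ h) / (2 * Real.pi * I * t ^ 2 * φ₁ h) -
        k / (2 * Real.pi * I * t ^ 2))‖ ≤ 16 * A ^ 6 * B / t ^ 3 := by
  have hA := H.one_le
  have hh := H.pos
  have hsub : Ioc 0 h ⊆ Icc 0 h := Ioc_subset_Icc_self
  have hh' : h ∈ Ioc 0 h := ⟨hh, le_rfl⟩
  obtain ⟨κ, hκ⟩ : ∃ κ : ℂ, κ = 2 * Real.pi * I * t ^ 2 := ⟨_, rfl⟩
  rw [← hκ]
  have hκn : t ^ 2 ≤ ‖κ‖ := by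
    rw [hκ]
    simp only [norm_mul, norm_pow, norm_I, Complex.norm_real, Complex.norm_ofNat, mul_one,
      Real.norm_of_nonneg Real.pi_pos.le, Real.norm_of_nonneg ht.le]
    nlinarith [Real.pi_gt_three, sq_nonneg t]
  have hκ0 : κ ≠ 0 := norm_pos_iff.1 ((by positivity : 0 < t ^ 2).trans_le hκn)
  have hφ1 : ∀ x ∈ Ioc 0 h, 0 < φ₁ x := by
    intro x hx
    have h1 := H.lower₁ x (hsub hx)
    by_contra! hc
    nlinarith [hx.1]
  have hφ1c : ∀ x ∈ Ioc 0 h, (φ₁ x : ℂ) ≠ 0 := fun x hx => by exact_mod_cast (hφ1 x hx).ne'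
  have hnorm1 : ∀ x ∈ Ioc 0 h, ‖(φ₁ x : ℂ)‖ ≤ A * x := fun x hx => by
    rw [Complex.norm_real]; exact H.upper₁ x (hsub hx)
  have hnorm1' : ∀ x ∈ Ioc 0 h, x / A ≤ ‖(φ₁ x : ℂ)‖ := fun x hx => by
    rw [Complex.norm_real, Real.norm_of_nonneg (hφ1 x hx).le, div_le_iff₀' (by positivity)]
    exact H.lower₁ x (hsub hx)
  have hnorm2 : ∀ x ∈ Ioc 0 h, ‖(φ₂ x : ℂ)‖ ≤ A := fun x hx => by
    rw [Complex.norm_real]; exact H.upper₂ x (hsub hx)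
  have hnorm3 : ∀ x ∈ Ioc 0 h, ‖(φ₃ x : ℂ)‖ ≤ A := fun x hx => by
    rw [Complex.norm_real]; exact H.upper₃ x (hsub hx)
  let E : ℝ → ℂ := fun x => ee (t ^ 2 * φ x)
  have hEn : ∀ x, ‖E x‖ = 1 := fun x => norm_ee _
  have hE : ∀ x ∈ Icc 0 h, HasDerivWithinAt E (κ * φ₁ x * E x) (Icc 0 h) x := by
    intro x hx
    refine (hasDerivWithinAt_ee (t ^ 2) (H.deriv₀ x hx)).congr_deriv ?_
    rw [hκ]
    push_cast
    rfl
  have hEc : ContinuousOn E (Icc 0 h) := fun x hx => (hE x hx).continuousWithinAt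
  have c1 : ContinuousOn (fun x => (φ₁ x : ℂ)) (Icc 0 h) := fun x hx =>
    (H.deriv₁ x hx).ofReal_comp.continuousWithinAt
  have c2 : ContinuousOn (fun x => (φ₂ x : ℂ)) (Icc 0 h) := fun x hx =>
    (H.deriv₂ x hx).ofReal_comp.continuousWithinAt
  have c3 : ContinuousOn (fun x => (φ₃ x : ℂ)) (Icc 0 h) := fun x hx =>
    (H.deriv₃ x hx).ofReal_comp.continuousWithinAt
  let P : ℝ → ℂ := fun x => N₁ x * φ₁ x - N x * φ₂ x
  let P' : ℝ → ℂ := fun x => N₂ x * φ₁ x - N x * φ₃ x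
  have hP : ∀ x ∈ Ioc 0 h, HasDerivWithinAt P (P' x) (Icc 0 h) x := by
    intro x hx
    refine (((hN₁ x hx).mul (H.deriv₁ x (hsub hx)).ofReal_comp).sub
      ((hN x hx).mul (H.deriv₂ x (hsub hx)).ofReal_comp)).congr_deriv ?_
    simp only [P']
    ring
  have hP'b : ∀ x ∈ Ioc 0 h, ‖P' x‖ ≤ 2 * A * B * x := by
    intro x hx
    have h1 := hN₂b x hx
    have h2 := hnorm1 x hx
    have h3 := hN0b x hx
    have h4 := hnorm3 x hx
    have hx0 := hx.1.le
    refine (norm_sub_le _ _).trans ?_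
    rw [norm_mul, norm_mul]
    calc _ ≤ B * (A * x) + B * x * A := by gcongr
      _ = _ := by ring
  have hPb : ∀ x ∈ Ioc 0 h, ‖P x‖ ≤ 2 * A * B * x ^ 2 := by
    refine norm_le_pow_of_deriv_le (m := 1) (by positivity) hP (by simpa using hP'b) ?_
    have hlin : Tendsto (fun x : ℝ => 2 * A * B * x) (𝓝[>] 0) (𝓝 0) := by
      have : Continuous fun x : ℝ => 2 * A * B * x := by fun_prop
      simpa using (this.tendsto 0).mono_left nhdsWithin_le_nhds
    refine squeeze_zero_norm' ?_ hlin
    filter_upwards [Ioc_mem_nhdsGT hh] with x hx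
    have h1 := hN₁b x hx
    have h2 := hnorm1 x hx
    have h3 := hN0b x hx
    have h4 := hnorm2 x hx
    have hx0 := hx.1.le
    refine (norm_sub_le _ _).trans ?_
    rw [norm_mul, norm_mul]
    calc _ ≤ B * (A * x) + B * x * A := by gcongr
      _ = _ := by ring
  let R : ℝ → ℂ := fun x => (P' x * φ₁ x - 3 * P x * φ₂ x) / φ₁ x ^ 4
  have hRb : ∀ x ∈ Ioc 0 h, ‖R x‖ ≤ 8 * A ^ 6 * B / x ^ 2 := by
    intro x hx
    have h1 := hP'b x hx
    have h2 := hnorm1 x hx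
    have h3 := hPb x hx
    have h4 := hnorm2 x hx
    have h5 := hnorm1' x hx
    have hx0 := hx.1
    have hnum : ‖P' x * φ₁ x - 3 * P x * φ₂ x‖ ≤ 8 * A ^ 2 * B * x ^ 2 := by
      refine (norm_sub_le _ _).trans ?_
      rw [norm_mul, norm_mul, norm_mul, Complex.norm_ofNat]
      calc _ ≤ 2 * A * B * x * (A * x) + 3 * (2 * A * B * x ^ 2) * A := by gcongr
        _ = _ := by ring
    simp only [R]
    rw [norm_div, norm_pow]
    calc _ ≤ 8 * A ^ 2 * B * x ^ 2 / (x / A) ^ 4 := by gcongr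
      _ = _ := by field_simp
  have hPdiv : ∀ x ∈ Ioc 0 h, ‖E x * (P x / (κ ^ 2 * φ₁ x ^ 3))‖ ≤ 2 * A ^ 4 * B / (t ^ 4 * x) := by
    intro x hx
    have h3 := hPb x hx
    have h5 := hnorm1' x hx
    have hx0 := hx.1
    rw [norm_mul, hEn, one_mul, norm_div, norm_mul, norm_pow, norm_pow]
    calc _ ≤ 2 * A * B * x ^ 2 / ((t ^ 2) ^ 2 * (x / A) ^ 3) := by gcongr
      _ = _ := by field_simp
  let G : ℝ → ℂ := fun x => E x * (N x / (κ * φ₁ x) - P x / (κ ^ 2 * φ₁ x ^ 3))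
  have hG : ∀ x ∈ Ioc 0 h, HasDerivWithinAt G (E x * N x - E x * (R x / κ ^ 2)) (Icc 0 h) x := by
    intro x hx
    have h0 := hφ1c x hx
    have d1 := (H.deriv₁ x (hsub hx)).ofReal_comp
    refine ((hE x (hsub hx)).mul (((hN x hx).div (d1.const_mul κ) (by simp [hκ0, h0])).sub
      ((hP x hx).div ((d1.pow 3).const_mul (κ ^ 2)) (by simp [hκ0, h0])))).congr_deriv ?_
    simp only [Pi.sub_apply, Pi.pow_apply, Pi.div_apply, R, P]
    push_cast
    field_simp
    ring
  have hx0 : 0 < 1 / t := by positivity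
  have hx0h : 1 / t ≤ h := by rw [div_le_iff₀' ht]; exact hth
  have hx0' : 1 / t ∈ Ioc 0 h := ⟨hx0, hx0h⟩
  have hIcc : Icc (1 / t) h ⊆ Ioc 0 h := fun x hx => ⟨hx0.trans_le hx.1, hx.2⟩
  have hIcc0 : Icc 0 (1 / t) ⊆ Icc 0 h := Icc_subset_Icc le_rfl hx0h
  have cP : ContinuousOn P (Ioc 0 h) := fun x hx => (hP x hx).continuousWithinAt.mono hsub
  have cR : ContinuousOn R (Ioc 0 h) := by
    have c1' := c1.mono hsub
    have c2' := c2.mono hsub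
    have c3' := c3.mono hsub
    have hN' := hNc.mono hsub
    refine ContinuousOn.div (by fun_prop) (by fun_prop) ?_
    intro x hx
    exact pow_ne_zero 4 (hφ1c x hx)
  have hNE : ContinuousOn (fun x => E x * N x) (Icc 0 h) := hEc.mul hNc
  have i1 : ∫ x in (1 / t)..h, (E x * N x - E x * (R x / κ ^ 2)) = G h - G (1 / t) := by
    refine integral_Icc_eq_sub_of_hasDerivWithinAt hx0h hx0.le le_rfl
      (fun x hx => hG x (hIcc hx)) ?_
    have := hNE.mono (hIcc.trans hsub)
    have := hEc.mono (hIcc.trans hsub)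
    have := cR.mono hIcc
    fun_prop
  have i2 : ∫ x in (1 / t)..h, (E x * N x - E x * (R x / κ ^ 2)) =
      (∫ x in (1 / t)..h, E x * N x) - ∫ x in (1 / t)..h, E x * (R x / κ ^ 2) := by
    refine intervalIntegral.integral_sub ?_ ?_
    · exact (hNE.mono (hIcc.trans hsub)).intervalIntegrable_of_Icc hx0h
    · refine ContinuousOn.intervalIntegrable_of_Icc hx0h ?_
      have := hEc.mono (hIcc.trans hsub)
      have := cR.mono hIcc
      fun_prop
  have e2 : ‖∫ x in (1 / t)..h, E x * (R x / κ ^ 2)‖ ≤ 8 * A ^ 6 * B / t ^ 3 := by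
    refine (norm_integral_inv_sq_le (C := 8 * A ^ 6 * B / t ^ 4) hx0 hx0h (by positivity)
      fun x hx => ?_).trans (le_of_eq (by field_simp))
    have h1 := hRb x (hIcc hx)
    have := (hIcc hx).1
    rw [norm_mul, hEn, one_mul, norm_div, norm_pow]
    calc _ ≤ 8 * A ^ 6 * B / x ^ 2 / (t ^ 2) ^ 2 := by gcongr
      _ = _ := by field_simp
  have j1 : ∫ x in (0 : ℝ)..(1 / t), κ * φ₁ x * E x = E (1 / t) - E 0 := by
    refine integral_Icc_eq_sub_of_hasDerivWithinAt hx0.le le_rfl hx0h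
      (fun x hx => hE x (hIcc0 hx)) ?_
    have := hEc.mono hIcc0
    have := c1.mono hIcc0
    fun_prop
  have j2 : (∫ x in (0 : ℝ)..(1 / t), E x * N x) =
      (∫ x in (0 : ℝ)..(1 / t), E x * (N x - k * φ₁ x)) +
        k / κ * ∫ x in (0 : ℝ)..(1 / t), κ * φ₁ x * E x := by
    have := hEc.mono hIcc0
    have := c1.mono hIcc0
    have := hNc.mono hIcc0
    rw [← intervalIntegral.integral_const_mul, ← intervalIntegral.integral_add]
    · refine intervalIntegral.integral_congr fun x _ => ?_
      field_simp
      ring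
    · refine ContinuousOn.intervalIntegrable_of_Icc hx0.le ?_
      fun_prop
    · refine ContinuousOn.intervalIntegrable_of_Icc hx0.le ?_
      fun_prop
  have e3 : ‖∫ x in (0 : ℝ)..(1 / t), E x * (N x - k * φ₁ x)‖ ≤ B / t ^ 3 := by
    refine (intervalIntegral.norm_integral_le_of_norm_le_const (C := B * (1 / t) ^ 2)
      fun x hx => ?_).trans (le_of_eq ?_)
    · rw [uIoc_of_le hx0.le] at hx
      have := hx.1
      have := hx.2
      rw [norm_mul, hEn, one_mul]
      refine (hNkb x ⟨hx.1, hx.2.trans hx0h⟩).trans ?_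
      gcongr
    · rw [sub_zero, abs_of_pos hx0]
      field_simp
  have hE0 : E 0 = 1 := by simp [E, H.zero₀, ee_zero]
  have i0 : (∫ x in (0 : ℝ)..h, N x * ee (t ^ 2 * φ x)) =
      (∫ x in (0 : ℝ)..(1 / t), E x * N x) + ∫ x in (1 / t)..h, E x * N x := by
    rw [intervalIntegral.integral_add_adjacent_intervals]
    · exact intervalIntegral.integral_congr fun x _ => mul_comm _ _
    · exact (hNE.mono hIcc0).intervalIntegrable_of_Icc hx0.le
    · exact (hNE.mono (hIcc.trans hsub)).intervalIntegrable_of_Icc hx0h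
  have e4 : ‖E (1 / t) * ((N (1 / t) - k * φ₁ (1 / t)) / (κ * φ₁ (1 / t)))‖ ≤ A * B / t ^ 3 := by
    have h1 := hNkb _ hx0'
    have h2 := hnorm1' _ hx0'
    rw [norm_mul, hEn, one_mul, norm_div, norm_mul]
    calc _ ≤ B * (1 / t) ^ 2 / (t ^ 2 * (1 / t / A)) := by gcongr
      _ = _ := by field_simp
  have e5 := hPdiv _ hx0'
  have e6 := hPdiv _ hh'
  have e5' : 2 * A ^ 4 * B / (t ^ 4 * (1 / t)) = 2 * A ^ 4 * B / t ^ 3 := by field_simp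
  have e6' : 2 * A ^ 4 * B / (t ^ 4 * h) ≤ 2 * A ^ 4 * B / t ^ 3 := by
    gcongr
    nlinarith [pow_pos ht 3]
  rw [e5'] at e5
  replace e6 := e6.trans e6'
  have hfin : (∫ x in (0 : ℝ)..h, N x * ee (t ^ 2 * φ x)) -
      (N h * ee (t ^ 2 * φ h) / (κ * φ₁ h) - k / κ) =
      (∫ x in (0 : ℝ)..(1 / t), E x * (N x - k * φ₁ x)) +
      (∫ x in (1 / t)..h, E x * (R x / κ ^ 2)) -
      E h * (P h / (κ ^ 2 * φ₁ h ^ 3)) + E (1 / t) * (P (1 / t) / (κ ^ 2 * φ₁ (1 / t) ^ 3)) -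
      E (1 / t) * ((N (1 / t) - k * φ₁ (1 / t)) / (κ * φ₁ (1 / t))) := by
    have e7 : (∫ x in (1 / t)..h, E x * N x) = G h - G (1 / t) +
        ∫ x in (1 / t)..h, E x * (R x / κ ^ 2) := by rw [← i1, i2]; ring
    rw [i0, j2, j1, hE0, e7]
    simp only [G]
    have := hφ1c _ hx0'
    have e8 : (N (1 / t) - k * φ₁ (1 / t)) / (κ * φ₁ (1 / t)) =
      N (1 / t) / (κ * φ₁ (1 / t)) - k / κ := by field_simp
    rw [e8]
    simp only [E]
    ring
  rw [hfin]
  have hA6 : A ≤ A ^ 6 := le_self_pow₀ hA (by norm_num)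
  have hA4 : A ^ 4 ≤ A ^ 6 := pow_le_pow_right₀ hA (by norm_num)
  have hA1 : 1 ≤ A ^ 6 := one_le_pow₀ hA
  calc _ ≤ B / t ^ 3 + 8 * A ^ 6 * B / t ^ 3 + 2 * A ^ 4 * B / t ^ 3 + 2 * A ^ 4 * B / t ^ 3 +
        A * B / t ^ 3 :=
      norm_sub_le_of_le (norm_add_le_of_le (norm_sub_le_of_le (norm_add_le_of_le e3 e2) e6) e5) e4
    _ = (1 + 8 * A ^ 6 + 4 * A ^ 4 + A) * B / t ^ 3 := by ring
    _ ≤ 16 * A ^ 6 * B / t ^ 3 := by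
      gcongr
      linarith

end NormalizedPhase

/-- A normalised amplitude, with uniform bounds for its derivatives up to order two. -/
structure NormalizedAmplitude (A h n : ℝ) (g g₁ g₂ : ℝ → ℂ) : Prop where
  nonneg : 0 ≤ n
  deriv₀ : ∀ x ∈ Icc 0 h, HasDerivWithinAt g (g₁ x) (Icc 0 h) x
  deriv₁ : ∀ x ∈ Icc 0 h, HasDerivWithinAt g₁ (g₂ x) (Icc 0 h) x
  cont₂ : ContinuousOn g₂ (Icc 0 h)
  upper₀ : ∀ x ∈ Icc 0 h, ‖g x‖ ≤ A
  upper₁ : ∀ x ∈ Icc 0 h, ‖g₁ x‖ ≤ A * n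
  upper₂ : ∀ x ∈ Icc 0 h, ‖g₂ x‖ ≤ A * n ^ 2

lemma NormalizedAmplitude.norm_sub_le {A h n : ℝ} {g g₁ g₂ : ℝ → ℂ}
    (hg : NormalizedAmplitude A h n g g₁ g₂) :
    ∀ x ∈ Ioc 0 h, ‖g x - g 0‖ ≤ A * n * x := by
  intro x hx
  have := (convex_Icc 0 h).norm_image_sub_le_of_norm_hasDerivWithin_le hg.deriv₀ hg.upper₁
    ⟨le_rfl, hx.1.le.trans hx.2⟩ (Ioc_subset_Icc_self hx)
  rwa [sub_zero, Real.norm_of_nonneg hx.1.le] at this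

lemma NormalizedAmplitude.norm_sub_sub_le {A h n : ℝ} {g g₁ g₂ : ℝ → ℂ} (hA : 1 ≤ A)
    (hg : NormalizedAmplitude A h n g g₁ g₂) :
    ∀ x ∈ Ioc 0 h, ‖g x - g 0 - g₁ 0 * x‖ ≤ A * n ^ 2 * x ^ 2 := by
  intro x hx
  have hn := hg.nonneg
  have hsub : Ioc 0 h ⊆ Icc 0 h := Ioc_subset_Icc_self
  refine norm_le_pow_of_deriv_le (m := 1) (F := fun x => g x - g 0 - g₁ 0 * x)
    (F' := fun x => g₁ x - g₁ 0) (by positivity) ?_ ?_ ?_ x hx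
  · intro y hy
    refine (((hg.deriv₀ y (hsub hy)).sub_const (g 0)).sub
      ((hasDerivWithinAt_id y _).ofReal_comp.const_mul (g₁ 0))).congr_deriv (by simp)
  · intro y hy
    have := (convex_Icc 0 h).norm_image_sub_le_of_norm_hasDerivWithin_le hg.deriv₁ hg.upper₂
      ⟨le_rfl, hy.1.le.trans hy.2⟩ (hsub hy)
    simpa only [pow_one, sub_zero, Real.norm_of_nonneg hy.1.le] using this
  · have h0 : ContinuousWithinAt g (Ioi 0) 0 :=
      ((hg.deriv₀ 0 ⟨le_rfl, hx.1.le.trans hx.2⟩).continuousWithinAt.mono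
        hsub).mono_of_mem_nhdsWithin (Ioc_mem_nhdsGT (hx.1.trans_le hx.2))
    have h1 : ContinuousWithinAt (fun x : ℝ => g x - g 0 - g₁ 0 * x) (Ioi 0) 0 := by fun_prop
    simpa [ContinuousWithinAt] using h1

namespace NormalizedPhase

variable {A h : ℝ} {φ φ₁ φ₂ φ₃ φ₄ : ℝ → ℝ}

lemma norm_inv_curvature_le (H : NormalizedPhase A h φ φ₁ φ₂ φ₃ φ₄) : ‖((φ₂ 0 : ℝ) : ℂ)⁻¹‖ ≤ A := by
  have hA := H.one_le
  have h0 := H.curvature_pos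
  have := H.lower₂ 0 ⟨le_rfl, H.pos.le⟩
  rw [norm_inv, Complex.norm_real, Real.norm_of_nonneg h0.le]
  exact inv_le_of_inv_le₀ (by positivity) (by rw [inv_le_iff_one_le_mul₀ (by positivity)]; linarith)

/-- The error in the one-sided stationary phase formula when the interval is long compared with
the wavelength at the stationary point. -/
lemma norm_integral_sub_main_le_of_one_le (H : NormalizedPhase A h φ φ₁ φ₂ φ₃ φ₄) {n t : ℝ}
    {g g₁ g₂ : ℝ → ℂ} (hg : NormalizedAmplitude A h n g g₁ g₂) (ht : 0 < t) (hth : 1 ≤ t * h) :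
    ‖(∫ x in (0 : ℝ)..h, g x * ee (t ^ 2 * φ x)) -
      (g 0 * ee (1 / 8) / (2 * t * √(φ₂ 0)) +
        g 0 * φ₃ 0 / (6 * Real.pi * I * t ^ 2 * φ₂ 0 ^ 2) +
        g h * ee (t ^ 2 * φ h) / (2 * Real.pi * I * t ^ 2 * φ₁ h) -
        g₁ 0 / (2 * Real.pi * I * t ^ 2 * φ₂ 0))‖
      ≤ 272 * A ^ 16 * (1 / (t ^ 4 * h ^ 3) + (1 + n) ^ 2 / t ^ 3) := by
  have hA := H.one_le
  have hh := H.pos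
  have hn := hg.nonneg
  have hsub : Ioc 0 h ⊆ Icc 0 h := Ioc_subset_Icc_self
  have h0mem : (0 : ℝ) ∈ Icc 0 h := ⟨le_rfl, hh.le⟩
  obtain ⟨q, q₁, q₂, hq0, hqe, hqd, hqd₁, hq₂c, hqb, hqb', hqb₁, hqb₂⟩ := H.exists_density
  have hqc : ContinuousOn q (Icc 0 h) := by
    intro x hx
    rcases hx.1.eq_or_lt with rfl | hx0
    · have hlin : Tendsto (fun x : ℝ => 2 * A ^ 4 * x) (𝓝[Icc 0 h] 0) (𝓝 0) := by
        have : Continuous fun x : ℝ => 2 * A ^ 4 * x := by fun_prop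
        simpa using (this.tendsto 0).mono_left nhdsWithin_le_nhds
      rw [ContinuousWithinAt, hq0, tendsto_iff_norm_sub_tendsto_zero]
      refine squeeze_zero' (Eventually.of_forall fun _ => norm_nonneg _) ?_ hlin
      filter_upwards [self_mem_nhdsWithin] with y hy
      rcases hy.1.eq_or_lt with rfl | hy0
      · simp [hq0]
      · exact hqb y ⟨hy0, hy.2⟩
    · exact (hqd x ⟨hx0, hx.2⟩).continuousWithinAt
  obtain ⟨m, hm⟩ : ∃ m : ℝ, m = φ₃ 0 / (3 * φ₂ 0) := ⟨_, rfl⟩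
  rw [← hm] at hqb'
  have hl0 := H.curvature_pos
  have hl0c : (φ₂ 0 : ℂ) ≠ 0 := by exact_mod_cast hl0.ne'
  have hinv := H.norm_inv_curvature_le
  have hν1 : 1 ≤ (1 + n) ^ 2 := one_le_pow₀ (by linarith)
  have hνn : n ≤ (1 + n) ^ 2 := by nlinarith
  have hνn2 : n ^ 2 ≤ (1 + n) ^ 2 := by nlinarith
  generalize (1 + n) ^ 2 = ν at *
  have hle : ∀ y : ℝ, 0 ≤ y → y ≤ y * ν := fun y hy => le_mul_of_one_le_right hy hν1
  have hg0 := hg.upper₀ 0 h0mem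
  have hmA : ‖(m : ℂ)‖ ≤ A ^ 2 := by
    have : (m : ℂ) = φ₃ 0 * (φ₂ 0 : ℂ)⁻¹ / 3 := by rw [hm]; push_cast; field_simp
    rw [this, norm_div, norm_mul, Complex.norm_real, Complex.norm_ofNat]
    have h3 : ‖φ₃ 0‖ ≤ A := H.upper₃ 0 h0mem
    calc _ ≤ A * A / 3 := by gcongr
      _ ≤ A ^ 2 := by nlinarith
  have hq' : ∀ x ∈ Ioc 0 h, ‖(q x : ℂ) - 1‖ ≤ 2 * A ^ 4 * x := by
    intro x hx
    have := hqb x hx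
    rwa [← Real.norm_eq_abs, ← Complex.norm_real, ofReal_sub, ofReal_one] at this
  have hq'' : ∀ x ∈ Ioc 0 h, ‖(q x : ℂ) - 1 - m * x‖ ≤ 4 * A ^ 8 * x ^ 2 := by
    intro x hx
    have := hqb' x hx
    rw [← Real.norm_eq_abs, ← Complex.norm_real] at this
    push_cast at this
    exact this
  have hrem := H.norm_integral_sub_boundary_le (N := fun x => g x - g 0 * q x)
    (N₁ := fun x => g₁ x - g 0 * q₁ x) (N₂ := fun x => g₂ x - g 0 * q₂ x)
    (k := (g₁ 0 - g 0 * m) * (φ₂ 0 : ℂ)⁻¹) (B := 17 * A ^ 10 * ν) ht hth (by positivity)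
    ?_ ?_ ?_ ?_ ?_ ?_ ?_ ?_
  · have hden := H.norm_integral_density_sub_le hqe hqc ht
    have hgc : ContinuousOn g (Icc 0 h) := fun x hx => (hg.deriv₀ x hx).continuousWithinAt
    have hqcc : ContinuousOn (fun x => (q x : ℂ)) (Icc 0 h) :=
      continuous_ofReal.comp_continuousOn hqc
    have hEc : ContinuousOn (fun x => ee (t ^ 2 * φ x)) (Icc 0 h) := by
      have : ContinuousOn φ (Icc 0 h) := fun x hx => (H.deriv₀ x hx).continuousWithinAt
      exact continuous_ee.comp_continuousOn (by fun_prop)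
    have hsplit : (∫ x in (0 : ℝ)..h, g x * ee (t ^ 2 * φ x)) =
        g 0 * (∫ x in (0 : ℝ)..h, (q x : ℂ) * ee (t ^ 2 * φ x)) +
        ∫ x in (0 : ℝ)..h, (g x - g 0 * q x) * ee (t ^ 2 * φ x) := by
      rw [← intervalIntegral.integral_const_mul, ← intervalIntegral.integral_add]
      · exact intervalIntegral.integral_congr fun x _ => by ring
      · exact ContinuousOn.intervalIntegrable_of_Icc hh.le (by fun_prop)
      · exact ContinuousOn.intervalIntegrable_of_Icc hh.le (by fun_prop)
    generalize (∫ x in (0 : ℝ)..h, (g x - g 0 * q x) * ee (t ^ 2 * φ x)) = J at *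
    generalize (∫ x in (0 : ℝ)..h, (q x : ℂ) * ee (t ^ 2 * φ x)) = L at *
    have hpi : (Real.pi : ℂ) ≠ 0 := by exact_mod_cast Real.pi_ne_zero
    have htc : (t : ℂ) ≠ 0 := by exact_mod_cast ht.ne'
    have heq : g 0 * L + J - (g 0 * ee (1 / 8) / (2 * t * √(φ₂ 0)) +
        g 0 * φ₃ 0 / (6 * Real.pi * I * t ^ 2 * φ₂ 0 ^ 2) +
        g h * ee (t ^ 2 * φ h) / (2 * Real.pi * I * t ^ 2 * φ₁ h) -
        g₁ 0 / (2 * Real.pi * I * t ^ 2 * φ₂ 0)) =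
        g 0 * (L - (ee (1 / 8) / (2 * t * √(φ₂ 0)) +
          q h * ee (t ^ 2 * φ h) / (2 * Real.pi * I * t ^ 2 * φ₁ h))) +
        (J - ((g h - g 0 * q h) * ee (t ^ 2 * φ h) / (2 * Real.pi * I * t ^ 2 * φ₁ h) -
          (g₁ 0 - g 0 * m) * (φ₂ 0 : ℂ)⁻¹ / (2 * Real.pi * I * t ^ 2))) := by
      have e1 : (g₁ 0 - g 0 * m) * (φ₂ 0 : ℂ)⁻¹ / (2 * Real.pi * I * t ^ 2) =
          g₁ 0 / (2 * Real.pi * I * t ^ 2 * φ₂ 0) -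
            g 0 * φ₃ 0 / (6 * Real.pi * I * t ^ 2 * φ₂ 0 ^ 2) := by
        rw [hm]
        push_cast
        field_simp
        ring
      rw [e1]
      ring
    rw [hsplit, heq]
    have hA16 : A ^ 5 ≤ A ^ 16 := pow_le_pow_right₀ hA (by norm_num)
    calc _ ≤ A * (A ^ 4 / (t ^ 4 * h ^ 3)) + 16 * A ^ 6 * (17 * A ^ 10 * ν) / t ^ 3 := by
          refine norm_add_le_of_le ?_ hrem
          rw [norm_mul]
          gcongr
      _ = A ^ 5 * (1 / (t ^ 4 * h ^ 3)) + 272 * A ^ 16 * (ν / t ^ 3) := by ring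
      _ ≤ (272 * A ^ 16) * (1 / (t ^ 4 * h ^ 3)) + 272 * A ^ 16 * (ν / t ^ 3) := by
          gcongr
          linarith [pow_nonneg (zero_le_one.trans hA) 16]
      _ = _ := by ring
  · have hgc : ContinuousOn g (Icc 0 h) := fun x hx => (hg.deriv₀ x hx).continuousWithinAt
    have hqcc : ContinuousOn (fun x => (q x : ℂ)) (Icc 0 h) :=
      continuous_ofReal.comp_continuousOn hqc
    fun_prop
  · exact fun x hx => (hg.deriv₀ x (hsub hx)).sub ((hqd x hx).ofReal_comp.const_mul _)
  · exact fun x hx => (hg.deriv₁ x (hsub hx)).sub ((hqd₁ x hx).ofReal_comp.const_mul _)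
  · have h1 := hg.cont₂.mono hsub
    have h2 : ContinuousOn (fun x => (q₂ x : ℂ)) (Ioc 0 h) :=
      continuous_ofReal.comp_continuousOn hq₂c
    fun_prop
  · intro x hx
    have h1 := hg.norm_sub_le x hx
    have h2 := hq' x hx
    have hx0 := hx.1
    have hA5 : A ^ 5 ≤ A ^ 10 := pow_le_pow_right₀ hA (by norm_num)
    have hA1 : A ≤ A ^ 10 := le_self_pow₀ hA (by norm_num)
    calc ‖g x - g 0 * q x‖ = ‖(g x - g 0) - g 0 * (q x - 1)‖ := by ring_nf
      _ ≤ A * n * x + A * (2 * A ^ 4 * x) := by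
          refine norm_sub_le_of_le h1 ?_
          rw [norm_mul]
          gcongr
      _ ≤ A * ν * x + A * (2 * A ^ 4 * x) * ν := by
          exact add_le_add (by gcongr) (hle _ (by positivity))
      _ = (A + 2 * A ^ 5) * ν * x := by ring
      _ ≤ _ := by
          gcongr
          linarith [pow_nonneg (zero_le_one.trans hA) 10]
  · intro x hx
    have h1 := hg.norm_sub_sub_le hA x hx
    have h2 := hq'' x hx
    have hx0 := hx.1
    have h3 : ‖g₁ 0 - g 0 * m‖ ≤ A * ν + A * A ^ 2 := by
      refine norm_sub_le_of_le ((hg.upper₁ 0 h0mem).trans (by gcongr)) ?_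
      rw [norm_mul]
      gcongr
    have h4 : ‖(φ₂ 0 : ℂ)⁻¹ * (φ₁ x - φ₂ 0 * x)‖ ≤ A * (A * x ^ 2) := by
      have := H.abs_deriv_sub_linear_le x (hsub hx)
      rw [← Real.norm_eq_abs, ← Complex.norm_real] at this
      push_cast at this
      rw [norm_mul]
      gcongr
    have hA9 : A ^ 9 ≤ A ^ 10 := pow_le_pow_right₀ hA (by norm_num)
    have hA5 : A ^ 5 ≤ A ^ 10 := pow_le_pow_right₀ hA (by norm_num)
    have hA3 : A ^ 3 ≤ A ^ 10 := pow_le_pow_right₀ hA (by norm_num)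
    have hA1 : A ≤ A ^ 10 := le_self_pow₀ hA (by norm_num)
    calc ‖g x - g 0 * q x - (g₁ 0 - g 0 * m) * (φ₂ 0 : ℂ)⁻¹ * φ₁ x‖
        = ‖(g x - g 0 - g₁ 0 * x) - g 0 * (q x - 1 - m * x) -
          (g₁ 0 - g 0 * m) * ((φ₂ 0 : ℂ)⁻¹ * (φ₁ x - φ₂ 0 * x))‖ := by
          congr 1
          field_simp
          ring
      _ ≤ A * n ^ 2 * x ^ 2 + A * (4 * A ^ 8 * x ^ 2) +
          (A * ν + A * A ^ 2) * (A * (A * x ^ 2)) := by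
          refine norm_sub_le_of_le (norm_sub_le_of_le h1 ?_) ?_
          · rw [norm_mul]
            gcongr
          · rw [norm_mul]
            gcongr
      _ ≤ A * ν * x ^ 2 + A * (4 * A ^ 8 * x ^ 2) * ν +
          (A * ν + A * A ^ 2 * ν) * (A * (A * x ^ 2)) := by
          exact add_le_add (add_le_add (by gcongr) (hle _ (by positivity)))
            (mul_le_mul_of_nonneg_right (add_le_add le_rfl (hle _ (by positivity)))
              (by positivity))
      _ = (A + 4 * A ^ 9 + A ^ 3 + A ^ 5) * ν * x ^ 2 := by ring
      _ ≤ _ := by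
          gcongr
          linarith [pow_nonneg (zero_le_one.trans hA) 10]
  · intro x hx
    have h1 := hg.upper₁ x (hsub hx)
    have h2 := hqb₁ x hx
    rw [← Real.norm_eq_abs, ← Complex.norm_real] at h2
    have hA7 : A ^ 7 ≤ A ^ 10 := pow_le_pow_right₀ hA (by norm_num)
    have hA1 : A ≤ A ^ 10 := le_self_pow₀ hA (by norm_num)
    calc ‖g₁ x - g 0 * q₁ x‖ ≤ A * n + A * (2 * A ^ 6) := by
          refine norm_sub_le_of_le h1 ?_
          rw [norm_mul]
          gcongr
      _ ≤ A * ν + A * (2 * A ^ 6) * ν := by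
          exact add_le_add (by gcongr) (hle _ (by positivity))
      _ = (A + 2 * A ^ 7) * ν := by ring
      _ ≤ _ := by
          gcongr
          linarith [pow_nonneg (zero_le_one.trans hA) 10]
  · intro x hx
    have h1 := hg.upper₂ x (hsub hx)
    have h2 := hqb₂ x hx
    rw [← Real.norm_eq_abs, ← Complex.norm_real] at h2
    have hA1 : A ≤ A ^ 10 := le_self_pow₀ hA (by norm_num)
    calc ‖g₂ x - g 0 * q₂ x‖ ≤ A * n ^ 2 + A * (16 * A ^ 9) := by
          refine norm_sub_le_of_le h1 ?_
          rw [norm_mul]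
          gcongr
      _ ≤ A * ν + A * (16 * A ^ 9) * ν := by
          exact add_le_add (by gcongr) (hle _ (by positivity))
      _ = (A + 16 * A ^ 10) * ν := by ring
      _ ≤ _ := by
          gcongr
          linarith [pow_nonneg (zero_le_one.trans hA) 10]

/-- The error in the one-sided stationary phase formula when the interval is short compared with
the wavelength at the stationary point: all terms are then dominated by the error. -/
lemma norm_integral_sub_main_le_of_lt_one (H : NormalizedPhase A h φ φ₁ φ₂ φ₃ φ₄) {n t : ℝ}
    {g g₁ g₂ : ℝ → ℂ} (hg : NormalizedAmplitude A h n g g₁ g₂) (ht : 0 < t) (hth : t * h < 1)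
    (hhA : h ≤ A) :
    ‖(∫ x in (0 : ℝ)..h, g x * ee (t ^ 2 * φ x)) -
      (g 0 * ee (1 / 8) / (2 * t * √(φ₂ 0)) +
        g 0 * φ₃ 0 / (6 * Real.pi * I * t ^ 2 * φ₂ 0 ^ 2) +
        g h * ee (t ^ 2 * φ h) / (2 * Real.pi * I * t ^ 2 * φ₁ h) -
        g₁ 0 / (2 * Real.pi * I * t ^ 2 * φ₂ 0))‖
      ≤ 272 * A ^ 16 * (1 / (t ^ 4 * h ^ 3) + (1 + n) ^ 2 / t ^ 3) := by
  have hA := H.one_le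
  have hh := H.pos
  have hn := hg.nonneg
  have h0mem : (0 : ℝ) ∈ Icc 0 h := ⟨le_rfl, hh.le⟩
  have hhmem : h ∈ Icc 0 h := ⟨hh.le, le_rfl⟩
  have hpi1 : 1 ≤ Real.pi := by linarith [Real.pi_gt_three]
  have hinv := H.norm_inv_curvature_le
  have hg0 := hg.upper₀ 0 h0mem
  obtain ⟨D, hD⟩ : ∃ D, D = 1 / (t ^ 4 * h ^ 3) := ⟨_, rfl⟩
  rw [← hD]
  have hD0 : 0 < D := by rw [hD]; positivity
  have hth0 : 0 < t * h := by positivity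
  have hp : ∀ k : ℕ, (t * h) ^ k ≤ 1 := fun k => pow_le_one₀ hth0.le hth.le
  have d1 : h ≤ D := by
    rw [hD, le_div_iff₀ (by positivity)]
    linarith [hp 4, show h * (t ^ 4 * h ^ 3) = (t * h) ^ 4 by ring]
  have d2 : 1 / t ≤ D := by
    rw [hD, div_le_div_iff₀ ht (by positivity)]
    nlinarith [hp 3]
  have d3 : 1 / t ^ 2 ≤ A * D := by
    rw [hD, mul_one_div, div_le_div_iff₀ (by positivity) (by positivity)]
    calc 1 * (t ^ 4 * h ^ 3) = h * (t * h) ^ 2 * t ^ 2 := by ring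
      _ ≤ A * 1 * t ^ 2 := by gcongr; exact hp 2
      _ = _ := by ring
  have d4 : 1 / (t ^ 2 * h) ≤ D := by
    rw [hD, div_le_div_iff₀ (by positivity) (by positivity)]
    calc 1 * (t ^ 4 * h ^ 3) = (t * h) ^ 2 * (t ^ 2 * h) := by ring
      _ ≤ 1 * (t ^ 2 * h) := by gcongr; exact hp 2
  have d5 : n / t ^ 2 ≤ (1 + n) ^ 2 / t ^ 3 + D := by
    have h1 : n / t ^ 2 ≤ n ^ 2 / t ^ 3 + 1 / t := by
      have : n ^ 2 / t ^ 3 + 1 / t - n / t ^ 2 = (n ^ 2 - n * t + t ^ 2) / t ^ 3 := by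
        field_simp
        ring
      have h2 : 0 ≤ (n ^ 2 - n * t + t ^ 2) / t ^ 3 :=
        div_nonneg (by nlinarith [sq_nonneg (n - t), sq_nonneg (n + t)]) (by positivity)
      linarith
    have h3 : n ^ 2 / t ^ 3 ≤ (1 + n) ^ 2 / t ^ 3 := by
      gcongr
      linarith
    linarith
  have b1 : ‖∫ x in (0 : ℝ)..h, g x * ee (t ^ 2 * φ x)‖ ≤ A * D := by
    refine (intervalIntegral.norm_integral_le_of_norm_le_const (C := A) fun x hx => ?_).trans ?_
    · rw [uIoc_of_le hh.le] at hx
      rw [norm_mul, norm_ee, mul_one]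
      exact hg.upper₀ x (Ioc_subset_Icc_self hx)
    · rw [sub_zero, abs_of_pos hh]
      gcongr
  have b2 : ‖g 0 * ee (1 / 8) / (2 * t * √(φ₂ 0))‖ ≤ A ^ 2 * D := by
    have hl := H.one_le_mul_sqrt
    have hl0 := Real.sqrt_pos.2 H.curvature_pos
    rw [norm_div, norm_mul, norm_mul, norm_mul, norm_ee, Complex.norm_real, Complex.norm_real,
      Complex.norm_ofNat, Real.norm_of_nonneg ht.le, Real.norm_of_nonneg hl0.le, mul_one]
    calc _ ≤ A ^ 2 * (1 / t) := by
          rw [mul_one_div, div_le_div_iff₀ (by positivity) ht]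
          calc ‖g 0‖ * t ≤ A * t * 1 := by rw [mul_one]; gcongr
            _ ≤ A * t * (A * √(φ₂ 0)) := by gcongr
            _ ≤ 2 * (A * t * (A * √(φ₂ 0))) := by
              linarith [show 0 ≤ A * t * (A * √(φ₂ 0)) by positivity]
            _ = _ := by ring
      _ ≤ _ := by gcongr
  have b3 : ‖g 0 * φ₃ 0 / (6 * Real.pi * I * t ^ 2 * φ₂ 0 ^ 2)‖ ≤ A ^ 5 * D := by
    have h3 : ‖φ₃ 0‖ ≤ A := H.upper₃ 0 h0mem
    have e : g 0 * φ₃ 0 / (6 * Real.pi * I * t ^ 2 * φ₂ 0 ^ 2) =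
        g 0 * φ₃ 0 * (φ₂ 0 : ℂ)⁻¹ ^ 2 * (1 / (6 * Real.pi * I * t ^ 2)) := by
      simp only [div_eq_mul_inv, mul_inv, inv_pow]
      ring
    have h4 : ‖1 / (6 * Real.pi * I * t ^ 2 : ℂ)‖ ≤ 1 / t ^ 2 := by
      simp only [norm_div, norm_mul, norm_pow, norm_I, Complex.norm_real, Complex.norm_ofNat,
        mul_one, norm_one, Real.norm_of_nonneg Real.pi_pos.le, Real.norm_of_nonneg ht.le]
      gcongr
      nlinarith [sq_nonneg t]
    rw [e, norm_mul, norm_mul, norm_mul, norm_pow, Complex.norm_real]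
    calc _ ≤ A * A * A ^ 2 * (A * D) := by
          gcongr
          exact h4.trans d3
      _ = _ := by ring
  have b4 : ‖g h * ee (t ^ 2 * φ h) / (2 * Real.pi * I * t ^ 2 * φ₁ h)‖ ≤ A ^ 2 * D := by
    have h1 := H.lower₁ h hhmem
    have h2 := hg.upper₀ h hhmem
    have h3 : 0 < φ₁ h := by
      by_contra! hc
      nlinarith
    simp only [norm_div, norm_mul, norm_pow, norm_I, Complex.norm_real, Complex.norm_ofNat,
      mul_one, norm_ee, Real.norm_of_nonneg Real.pi_pos.le, Real.norm_of_nonneg ht.le,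
      Real.norm_of_nonneg h3.le]
    calc _ ≤ A ^ 2 * (1 / (t ^ 2 * h)) := by
          rw [mul_one_div, div_le_div_iff₀ (by positivity) (by positivity)]
          calc ‖g h‖ * (t ^ 2 * h) ≤ A * (t ^ 2 * (A * φ₁ h)) := by gcongr
            _ = (1 * 1) * (A ^ 2 * t ^ 2 * φ₁ h) := by ring
            _ ≤ (2 * Real.pi) * (A ^ 2 * t ^ 2 * φ₁ h) := by gcongr; norm_num
            _ = _ := by ring
      _ ≤ _ := by gcongr
  have b5 : ‖g₁ 0 / (2 * Real.pi * I * t ^ 2 * φ₂ 0)‖ ≤ A ^ 2 * ((1 + n) ^ 2 / t ^ 3 + D) := by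
    have h1 := hg.upper₁ 0 h0mem
    have e : g₁ 0 / (2 * Real.pi * I * t ^ 2 * φ₂ 0) =
        g₁ 0 * (φ₂ 0 : ℂ)⁻¹ * (1 / (2 * Real.pi * I * t ^ 2)) := by
      simp only [div_eq_mul_inv, mul_inv]
      ring
    have h4 : ‖1 / (2 * Real.pi * I * t ^ 2 : ℂ)‖ ≤ 1 / t ^ 2 := by
      simp only [norm_div, norm_mul, norm_pow, norm_I, Complex.norm_real, Complex.norm_ofNat,
        mul_one, norm_one, Real.norm_of_nonneg Real.pi_pos.le, Real.norm_of_nonneg ht.le]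
      gcongr
      nlinarith [sq_nonneg t]
    rw [e, norm_mul, norm_mul]
    calc _ ≤ A * n * A * (1 / t ^ 2) := by gcongr
      _ = A ^ 2 * (n / t ^ 2) := by ring
      _ ≤ _ := by gcongr
  have hν : 0 ≤ (1 + n) ^ 2 / t ^ 3 := by positivity
  have hA16 : A ≤ A ^ 16 := le_self_pow₀ hA (by norm_num)
  have hA2 : A ^ 2 ≤ A ^ 16 := pow_le_pow_right₀ hA (by norm_num)
  have hA5 : A ^ 5 ≤ A ^ 16 := pow_le_pow_right₀ hA (by norm_num)
  calc _ ≤ A * D + (A ^ 2 * D + A ^ 5 * D + A ^ 2 * D + A ^ 2 * ((1 + n) ^ 2 / t ^ 3 + D)) :=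
        norm_sub_le_of_le b1 (norm_sub_le_of_le (norm_add_le_of_le (norm_add_le_of_le b2 b3) b4) b5)
    _ = (A + A ^ 2 + A ^ 5 + A ^ 2 + A ^ 2) * D + A ^ 2 * ((1 + n) ^ 2 / t ^ 3) := by ring
    _ ≤ (272 * A ^ 16) * D + (272 * A ^ 16) * ((1 + n) ^ 2 / t ^ 3) := by
        gcongr <;> linarith [pow_nonneg (zero_le_one.trans hA) 16]
    _ = _ := by ring

/-- The one-sided stationary phase formula for a normalised phase and amplitude. -/
lemma norm_integral_sub_main_le (H : NormalizedPhase A h φ φ₁ φ₂ φ₃ φ₄) {n t : ℝ}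
    {g g₁ g₂ : ℝ → ℂ} (hg : NormalizedAmplitude A h n g g₁ g₂) (ht : 0 < t) (hhA : h ≤ A) :
    ‖(∫ x in (0 : ℝ)..h, g x * ee (t ^ 2 * φ x)) -
      (g 0 * ee (1 / 8) / (2 * t * √(φ₂ 0)) +
        g 0 * φ₃ 0 / (6 * Real.pi * I * t ^ 2 * φ₂ 0 ^ 2) +
        g h * ee (t ^ 2 * φ h) / (2 * Real.pi * I * t ^ 2 * φ₁ h) -
        g₁ 0 / (2 * Real.pi * I * t ^ 2 * φ₂ 0))‖
      ≤ 272 * A ^ 16 * (1 / (t ^ 4 * h ^ 3) + (1 + n) ^ 2 / t ^ 3) := by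
  rcases le_or_gt 1 (t * h) with hth | hth
  · exact H.norm_integral_sub_main_le_of_one_le hg ht hth
  · exact H.norm_integral_sub_main_le_of_lt_one hg ht hth hhA

end NormalizedPhase

lemma hasDerivWithinAt_comp_affine {E : Type*} [NormedAddCommGroup E] [NormedSpace ℝ E]
    {F : ℝ → E} {F' : E} {c s x : ℝ} {S R : Set ℝ} (hF : HasDerivWithinAt F F' S (c + s * x))
    (hR : MapsTo (fun y => c + s * y) R S) :
    HasDerivWithinAt (fun y => F (c + s * y)) (s • F') R x := by
  have h1 : HasDerivWithinAt (fun y => c + s * y) s R x := by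
    simpa using ((hasDerivWithinAt_id x R).const_mul s).const_add c
  exact hF.scomp x h1 hR

/-- The one-sided stationary phase formula on the segment from the stationary point `c` to
`c + s * h`, where `s` has absolute value `M` and sign `σ`. -/
lemma norm_integral_sub_stationary_le {A M N t U a b c h s σ : ℝ} {f f₁ f₂ f₃ f₄ : ℝ → ℝ}
    {g g₁ g₂ : ℝ → ℂ} (hA : 1 ≤ A) (hM : 0 < M) (hN : 0 < N) (ht : 0 < t) (hU : 0 < U)
    (hσ : |σ| = 1) (hs : s = σ * M) (hh : 0 < h) (hhA : h ≤ A)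
    (hmaps : MapsTo (fun y => c + s * y) (Icc 0 h) (Icc a b))
    (df : ∀ x ∈ Icc a b, HasDerivWithinAt f (f₁ x) (Icc a b) x)
    (df₁ : ∀ x ∈ Icc a b, HasDerivWithinAt f₁ (f₂ x) (Icc a b) x)
    (df₂ : ∀ x ∈ Icc a b, HasDerivWithinAt f₂ (f₃ x) (Icc a b) x)
    (df₃ : ∀ x ∈ Icc a b, HasDerivWithinAt f₃ (f₄ x) (Icc a b) x)
    (cf₄ : ContinuousOn f₄ (Icc a b))
    (dg : ∀ x ∈ Icc a b, HasDerivWithinAt g (g₁ x) (Icc a b) x)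
    (dg₁ : ∀ x ∈ Icc a b, HasDerivWithinAt g₁ (g₂ x) (Icc a b) x)
    (cg₂ : ContinuousOn g₂ (Icc a b)) (hc : f₁ c = 0)
    (lf₂ : ∀ x ∈ Icc a b, t ^ 2 / (A * M ^ 2) ≤ f₂ x)
    (uf₂ : ∀ x ∈ Icc a b, |f₂ x| ≤ A * t ^ 2 / M ^ 2)
    (uf₃ : ∀ x ∈ Icc a b, |f₃ x| ≤ A * t ^ 2 / M ^ 3)
    (uf₄ : ∀ x ∈ Icc a b, |f₄ x| ≤ A * t ^ 2 / M ^ 4)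
    (ug : ∀ x ∈ Icc a b, ‖g x‖ ≤ A * U)
    (ug₁ : ∀ x ∈ Icc a b, ‖g₁ x‖ ≤ A * U / N)
    (ug₂ : ∀ x ∈ Icc a b, ‖g₂ x‖ ≤ A * U / N ^ 2) :
    ‖(∫ x in c..(c + s * h), g x * ee (f x)) -
      (σ * (g c * ee (f c + 1 / 8) / (2 * √(f₂ c))) +
        g c * f₃ c * ee (f c) / (6 * Real.pi * I * f₂ c ^ 2) +
        g (c + s * h) * ee (f (c + s * h)) / (2 * Real.pi * I * f₁ (c + s * h)) -
        g₁ c * ee (f c) / (2 * Real.pi * I * f₂ c))‖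
      ≤ 272 * A ^ 16 * (U * M * (1 / (t ^ 4 * h ^ 3) + (1 + M / N) ^ 2 / t ^ 3)) := by
  have hs1 : |s| = M := by rw [hs, abs_mul, hσ, one_mul, abs_of_pos hM]
  have hs2 : s ^ 2 = M ^ 2 := by rw [← sq_abs, hs1]
  have hs0 : s ≠ 0 := by
    rw [← abs_pos, hs1]
    exact hM
  have hc0 : c ∈ Icc a b := by simpa using hmaps ⟨le_rfl, hh.le⟩
  have hf₂ : 0 < f₂ c := lt_of_lt_of_le (by positivity) (lf₂ c hc0)
  have cont : ContinuousOn (fun y => c + s * y) (Icc 0 h) := by fun_prop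
  have H : NormalizedPhase A h (fun y => (f (c + s * y) - f c) / t ^ 2)
      (fun y => s * f₁ (c + s * y) / t ^ 2) (fun y => s ^ 2 * f₂ (c + s * y) / t ^ 2)
      (fun y => s ^ 3 * f₃ (c + s * y) / t ^ 2) (fun y => s ^ 4 * f₄ (c + s * y) / t ^ 2) := by
    refine ⟨hA, hh, fun x hx => ?_, fun x hx => ?_, fun x hx => ?_, fun x hx => ?_, ?_, ?_, ?_,
      fun x hx => ?_, fun x hx => ?_, fun x hx => ?_, fun x hx => ?_⟩
    · exact ((hasDerivWithinAt_comp_affine (df _ (hmaps hx)) hmaps).sub_const (f c)).div_const _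
    · refine (((hasDerivWithinAt_comp_affine (df₁ _ (hmaps hx)) hmaps).const_mul s).div_const
        _).congr_deriv ?_
      rw [smul_eq_mul]
      ring
    · refine (((hasDerivWithinAt_comp_affine (df₂ _ (hmaps hx)) hmaps).const_mul
        (s ^ 2)).div_const _).congr_deriv ?_
      rw [smul_eq_mul]
      ring
    · refine (((hasDerivWithinAt_comp_affine (df₃ _ (hmaps hx)) hmaps).const_mul
        (s ^ 3)).div_const _).congr_deriv ?_
      rw [smul_eq_mul]
      ring
    · exact ((cf₄.comp cont hmaps).const_smul (s ^ 4)).div_const _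
    · simp
    · simp [hc]
    · have := lf₂ _ (hmaps hx)
      rw [div_le_iff₀ (by positivity)] at this
      rw [← mul_div_assoc, le_div_iff₀ (by positivity), hs2]
      linarith
    · have := uf₂ _ (hmaps hx)
      rw [le_div_iff₀ (by positivity)] at this
      rw [abs_div, abs_mul, abs_pow, hs1, abs_of_pos (pow_pos ht 2), div_le_iff₀ (by positivity)]
      linarith
    · have := uf₃ _ (hmaps hx)
      rw [le_div_iff₀ (by positivity)] at this
      rw [abs_div, abs_mul, abs_pow, hs1, abs_of_pos (pow_pos ht 2), div_le_iff₀ (by positivity)]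
      linarith
    · have := uf₄ _ (hmaps hx)
      rw [le_div_iff₀ (by positivity)] at this
      rw [abs_div, abs_mul, abs_pow, hs1, abs_of_pos (pow_pos ht 2), div_le_iff₀ (by positivity)]
      linarith
  have hg : NormalizedAmplitude A h (M / N) (fun y => g (c + s * y) / U)
      (fun y => s * g₁ (c + s * y) / U) (fun y => s ^ 2 * g₂ (c + s * y) / U) := by
    refine ⟨by positivity, fun x hx => ?_, fun x hx => ?_, ?_, fun x hx => ?_, fun x hx => ?_,
      fun x hx => ?_⟩
    · refine ((hasDerivWithinAt_comp_affine (dg _ (hmaps hx)) hmaps).div_const _).congr_deriv ?_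
      rw [Complex.real_smul]
    · refine (((hasDerivWithinAt_comp_affine (dg₁ _ (hmaps hx)) hmaps).const_mul
        (s : ℂ)).div_const _).congr_deriv ?_
      rw [Complex.real_smul]
      ring
    · exact ((cg₂.comp cont hmaps).const_smul ((s : ℂ) ^ 2)).div_const _
    · rw [norm_div, Complex.norm_real, Real.norm_of_nonneg hU.le, div_le_iff₀ hU]
      exact ug _ (hmaps hx)
    · rw [norm_div, norm_mul, Complex.norm_real, Complex.norm_real, Real.norm_of_nonneg hU.le,
        Real.norm_eq_abs, hs1, div_le_iff₀ hU]
      calc M * ‖g₁ (c + s * x)‖ ≤ M * (A * U / N) := by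
            gcongr
            exact ug₁ _ (hmaps hx)
        _ = _ := by ring
    · rw [norm_div, norm_mul, norm_pow, Complex.norm_real, Complex.norm_real,
        Real.norm_of_nonneg hU.le, Real.norm_eq_abs, hs1, div_le_iff₀ hU]
      calc M ^ 2 * ‖g₂ (c + s * x)‖ ≤ M ^ 2 * (A * U / N ^ 2) := by
            gcongr
            exact ug₂ _ (hmaps hx)
        _ = _ := by ring
  have key := H.norm_integral_sub_main_le hg ht hhA
  have hee : ∀ y, ee (f c) * ee (t ^ 2 * ((f (c + s * y) - f c) / t ^ 2)) = ee (f (c + s * y)) := by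
    intro y
    rw [← ee_add]
    congr 1
    field_simp
    ring
  have hUc : (U : ℂ) ≠ 0 := by exact_mod_cast hU.ne'
  have hsc : (s : ℂ) ≠ 0 := by exact_mod_cast hs0
  have htc : (t : ℂ) ≠ 0 := by exact_mod_cast ht.ne'
  have hMc : (M : ℂ) ≠ 0 := by exact_mod_cast hM.ne'
  have hfc : (f₂ c : ℂ) ≠ 0 := by exact_mod_cast hf₂.ne'
  have hpi : (Real.pi : ℂ) ≠ 0 := by exact_mod_cast Real.pi_ne_zero
  have hsqc : (√(f₂ c) : ℂ) ≠ 0 := by exact_mod_cast (Real.sqrt_pos.2 hf₂).ne'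
  have hint : (∫ x in c..(c + s * h), g x * ee (f x)) = s * U * ee (f c) *
      ∫ x in (0 : ℝ)..h, g (c + s * x) / U * ee (t ^ 2 * ((f (c + s * x) - f c) / t ^ 2)) := by
    have := intervalIntegral.smul_integral_comp_add_mul (a := 0) (b := h)
      (fun x => g x * ee (f x)) s c
    rw [mul_zero, add_zero] at this
    rw [← this, Complex.real_smul, ← intervalIntegral.integral_const_mul,
      ← intervalIntegral.integral_const_mul]
    refine intervalIntegral.integral_congr fun x _ => ?_
    simp only [← hee x]
    field_simp
  have hsqrt : √(s ^ 2 * f₂ (c + s * 0) / t ^ 2) = M * √(f₂ c) / t := by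
    rw [mul_zero, add_zero, Real.sqrt_div' _ (by positivity), Real.sqrt_mul (by positivity), hs2,
      Real.sqrt_sq hM.le, Real.sqrt_sq ht.le]
  have hmain : (σ * (g c * ee (f c + 1 / 8) / (2 * √(f₂ c))) +
        g c * f₃ c * ee (f c) / (6 * Real.pi * I * f₂ c ^ 2) +
        g (c + s * h) * ee (f (c + s * h)) / (2 * Real.pi * I * f₁ (c + s * h)) -
        g₁ c * ee (f c) / (2 * Real.pi * I * f₂ c)) = s * U * ee (f c) *
      (g (c + s * 0) / U * ee (1 / 8) / (2 * t * √(s ^ 2 * f₂ (c + s * 0) / t ^ 2)) +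
        g (c + s * 0) / U * (s ^ 3 * f₃ (c + s * 0) / t ^ 2 : ℝ) /
          (6 * Real.pi * I * t ^ 2 * (s ^ 2 * f₂ (c + s * 0) / t ^ 2 : ℝ) ^ 2) +
        g (c + s * h) / U * ee (t ^ 2 * ((f (c + s * h) - f c) / t ^ 2)) /
          (2 * Real.pi * I * t ^ 2 * (s * f₁ (c + s * h) / t ^ 2 : ℝ)) -
        s * g₁ (c + s * 0) / U /
          (2 * Real.pi * I * t ^ 2 * (s ^ 2 * f₂ (c + s * 0) / t ^ 2 : ℝ))) := by
    rw [hsqrt, mul_sub, mul_add, mul_add, ← hee h, ee_add, mul_zero, add_zero]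
    push_cast
    have hsσ : (s : ℂ) = σ * M := by rw [hs, ofReal_mul]
    congr 1
    · congr 1
      · congr 1
        · rw [hsσ]
          field_simp
        · field_simp
      · simp only [div_eq_mul_inv, mul_inv, inv_inv]
        field_simp
    · field_simp
  rw [hint, hmain, ← mul_sub, norm_mul, norm_mul, norm_mul, norm_ee, Complex.norm_real,
    Complex.norm_real, Real.norm_of_nonneg hU.le, Real.norm_eq_abs, hs1, mul_one]
  calc _ ≤ M * U * (272 * A ^ 16 * (1 / (t ^ 4 * h ^ 3) + (1 + M / N) ^ 2 / t ^ 3)) := by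
        gcongr
    _ = _ := by ring

/-- The one-sided stationary phase formula in terms of iterated derivatives within `[a, b]`. -/
lemma norm_integral_sub_stationary_iteratedDerivWithin_le {A M N T U a b c d σ : ℝ} {f : ℝ → ℝ}
    {g : ℝ → ℂ} (hA : 1 ≤ A) (hM : 0 < M) (hN : 0 < N) (hT : 0 < T) (hU : 0 < U)
    (hσ : |σ| = 1) (hab : a < b) (hf : ContDiffOn ℝ 4 f (Icc a b))
    (hg : ContDiffOn ℝ 3 g (Icc a b)) (hc : c ∈ Icc a b) (hd : d ∈ Icc a b)
    (hcd : 0 < σ * (d - c)) (hdA : b - a ≤ A * M)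
    (hf₁ : iteratedDerivWithin 1 f (Icc a b) c = 0)
    (lf₂ : ∀ x ∈ Icc a b, T / (A * M ^ 2) ≤ iteratedDerivWithin 2 f (Icc a b) x)
    (uf₂ : ∀ x ∈ Icc a b, |iteratedDerivWithin 2 f (Icc a b) x| ≤ A * T / M ^ 2)
    (uf₃ : ∀ x ∈ Icc a b, |iteratedDerivWithin 3 f (Icc a b) x| ≤ A * T / M ^ 3)
    (uf₄ : ∀ x ∈ Icc a b, |iteratedDerivWithin 4 f (Icc a b) x| ≤ A * T / M ^ 4)
    (ug : ∀ x ∈ Icc a b, ‖g x‖ ≤ A * U)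
    (ug₁ : ∀ x ∈ Icc a b, ‖derivWithin g (Icc a b) x‖ ≤ A * U / N)
    (ug₂ : ∀ x ∈ Icc a b, ‖iteratedDerivWithin 2 g (Icc a b) x‖ ≤ A * U / N ^ 2) :
    ‖(∫ x in c..d, g x * ee (f x)) -
      (σ * (g c * ee (f c + 1 / 8) / (2 * √(iteratedDerivWithin 2 f (Icc a b) c))) +
        g c * iteratedDerivWithin 3 f (Icc a b) c * ee (f c) /
          (6 * Real.pi * I * iteratedDerivWithin 2 f (Icc a b) c ^ 2) +
        g d * ee (f d) / (2 * Real.pi * I * iteratedDerivWithin 1 f (Icc a b) d) -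
        derivWithin g (Icc a b) c * ee (f c) /
          (2 * Real.pi * I * iteratedDerivWithin 2 f (Icc a b) c))‖
      ≤ 272 * A ^ 16 * (U * M ^ 4 / (T ^ 2 * (σ * (d - c)) ^ 3) +
        U * M / T ^ ((3 : ℝ) / 2) * (1 + M / N) ^ 2) := by
  have hu : UniqueDiffOn ℝ (Icc a b) := uniqueDiffOn_Icc hab
  have hder {E : Type} [NormedAddCommGroup E] [NormedSpace ℝ E] {F : ℝ → E} {n : ℕ}
      (hF : ContDiffOn ℝ (n + 1 : ℕ) F (Icc a b)) (x : ℝ) (hx : x ∈ Icc a b) :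
      HasDerivWithinAt (iteratedDerivWithin n F (Icc a b))
        (iteratedDerivWithin (n + 1) F (Icc a b) x) (Icc a b) x := by
    rw [iteratedDerivWithin_succ]
    exact (hF.differentiableOn_iteratedDerivWithin (by exact_mod_cast n.lt_succ_self) hu x
      hx).hasDerivWithinAt
  have hσ2 : σ * σ = 1 := by rw [← abs_mul_abs_self, hσ, one_mul]
  have hh : 0 < σ * (d - c) / M := by positivity
  have hd' : c + σ * M * (σ * (d - c) / M) = d := by
    have : σ * M * (σ * (d - c) / M) = (σ * σ) * (d - c) := by field_simp
    rw [this, hσ2]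
    ring
  have hdc : σ * (d - c) ≤ b - a := by
    refine (le_abs_self _).trans ?_
    rw [abs_mul, hσ, one_mul, abs_le]
    constructor <;> linarith [hc.1, hc.2, hd.1, hd.2]
  have hmaps : MapsTo (fun y => c + σ * M * y) (Icc 0 (σ * (d - c) / M)) (Icc a b) := by
    intro y hy
    have : c + σ * M * y = (1 - y / (σ * (d - c) / M)) * c + (y / (σ * (d - c) / M)) * d := by
      have hne := right_ne_zero_of_mul hcd.ne'
      have hσ0 := left_ne_zero_of_mul hcd.ne'
      field_simp
      linear_combination y * M * (d - c) * hσ2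
    simp only [this]
    exact convex_Icc a b hc hd (sub_nonneg.2 ((div_le_one hh).2 hy.2)) (div_nonneg hy.1 hh.le)
      (by ring)
  have hT2 : √T ^ 2 = T := Real.sq_sqrt hT.le
  have hT3 : T ^ ((3 : ℝ) / 2) = √T ^ 3 := by
    rw [Real.sqrt_eq_rpow, ← Real.rpow_natCast, ← Real.rpow_mul hT.le]
    norm_num
  have key := norm_integral_sub_stationary_le (t := √T) (h := σ * (d - c) / M)
    (f := f) (f₁ := iteratedDerivWithin 1 f (Icc a b)) (f₂ := iteratedDerivWithin 2 f (Icc a b))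
    (f₃ := iteratedDerivWithin 3 f (Icc a b)) (f₄ := iteratedDerivWithin 4 f (Icc a b))
    (g := g) (g₁ := derivWithin g (Icc a b)) (g₂ := iteratedDerivWithin 2 g (Icc a b))
    hA hM hN (Real.sqrt_pos.2 hT) hU hσ rfl hh ((div_le_iff₀ hM).2 (hdc.trans hdA)) hmaps
    (by simpa using hder (n := 0) (hf.of_le (by norm_num)))
    (hder (n := 1) (hf.of_le (by norm_num)))
    (hder (n := 2) (hf.of_le (by norm_num)))
    (hder (n := 3) (hf.of_le (by norm_num)))
    (hf.continuousOn_iteratedDerivWithin (by norm_num) hu)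
    (by simpa using hder (n := 0) (hg.of_le (by norm_num)))
    (by simpa using hder (n := 1) (hg.of_le (by norm_num)))
    (hg.continuousOn_iteratedDerivWithin (by norm_num) hu) hf₁
    (by rwa [hT2]) (by rwa [hT2]) (by rwa [hT2]) (by rwa [hT2]) ug ug₁ ug₂
  rw [hd'] at key
  refine key.trans_eq ?_
  rw [hT3, show √T ^ 4 = T ^ 2 by
    linear_combination (√T ^ 2 + T) * hT2]
  field_simp

/-- Combined stationary-phase estimate of Redouaby–Sargos: one-sided integrals
through a stationary phase point `c`, with explicit main terms and error terms
`O(UM⁴/(T²|·−c|³)) + O(UM/T^{3/2}(1+M/N)²)`, the implicit constants depending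
only on `C₂₋, C₂, C₃, C₄, C_M, D₀, D₁, D₂, δ`. -/
theorem stmt7 (C2m C2 C3 C4 CM D0 D1 D2 δ : ℝ)
    (hC2m : 0 < C2m) (hC2 : 0 < C2) (hC3 : 0 < C3) (hC4 : 0 < C4) (hCM : 0 < CM)
    (hD0 : 0 < D0) (hD1 : 0 < D1) (hD2 : 0 < D2) (hδ0 : 0 < δ) (hδ1 : δ < 1) :
    ∃ K > 0, ∀ (a b c T M N U : ℝ) (f : ℝ → ℝ) (g : ℝ → ℂ),
      a ≤ b → 0 < T → 0 < M → 0 < N → 0 < U →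
      ContDiffOn ℝ 4 f (Set.Icc a b) →
      ContDiffOn ℝ 3 g (Set.Icc a b) →
      (∀ z ∈ Set.Icc a b,
        T / (C2m * M ^ 2) ≤ iteratedDerivWithin 2 f (Set.Icc a b) z ∧
        |iteratedDerivWithin 2 f (Set.Icc a b) z| ≤ C2 * T / M ^ 2 ∧
        |iteratedDerivWithin 3 f (Set.Icc a b) z| ≤ C3 * T / M ^ 3 ∧
        |iteratedDerivWithin 4 f (Set.Icc a b) z| ≤ C4 * T / M ^ 4 ∧
        ‖g z‖ ≤ D0 * U ∧
        ‖derivWithin g (Set.Icc a b) z‖ ≤ D1 * U / N ∧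
        ‖iteratedDerivWithin 2 g (Set.Icc a b) z‖ ≤ D2 * U / N ^ 2) →
      b - a ≤ CM * M →
      c ∈ Set.Icc a b →
      iteratedDerivWithin 1 f (Set.Icc a b) c = 0 →
      ((0 < c - a → c - a ≤ (3 * δ / (C2m * C3)) * M →
        ‖(∫ x in a..c, g x * ee (f x))
          - (g c * ee (f c + 1/8) /
              (2 * (↑(Real.sqrt (iteratedDerivWithin 2 f (Set.Icc a b) c)) : ℂ))
            - g c * (↑(iteratedDerivWithin 3 f (Set.Icc a b) c) : ℂ) * ee (f c) /
              (6 * (Real.pi : ℂ) * Complex.I *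
                (↑(iteratedDerivWithin 2 f (Set.Icc a b) c) : ℂ) ^ 2)
            - g a * ee (f a) /
              (2 * (Real.pi : ℂ) * Complex.I *
                (↑(iteratedDerivWithin 1 f (Set.Icc a b) a) : ℂ))
            + derivWithin g (Set.Icc a b) c * ee (f c) /
              (2 * (Real.pi : ℂ) * Complex.I *
                (↑(iteratedDerivWithin 2 f (Set.Icc a b) c) : ℂ)))‖
        ≤ K * (U * M ^ 4 / (T ^ 2 * (c - a) ^ 3)
            + (U * M / T ^ ((3 : ℝ) / 2)) * (1 + M / N) ^ 2)) ∧
      (0 < b - c → b - c ≤ (3 * δ / (C2m * C3)) * M →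
        ‖(∫ x in c..b, g x * ee (f x))
          - (g c * ee (f c + 1/8) /
              (2 * (↑(Real.sqrt (iteratedDerivWithin 2 f (Set.Icc a b) c)) : ℂ))
            + g c * (↑(iteratedDerivWithin 3 f (Set.Icc a b) c) : ℂ) * ee (f c) /
              (6 * (Real.pi : ℂ) * Complex.I *
                (↑(iteratedDerivWithin 2 f (Set.Icc a b) c) : ℂ) ^ 2)
            + g b * ee (f b) /
              (2 * (Real.pi : ℂ) * Complex.I *
                (↑(iteratedDerivWithin 1 f (Set.Icc a b) b) : ℂ))
            - derivWithin g (Set.Icc a b) c * ee (f c) /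
              (2 * (Real.pi : ℂ) * Complex.I *
                (↑(iteratedDerivWithin 2 f (Set.Icc a b) c) : ℂ)))‖
        ≤ K * (U * M ^ 4 / (T ^ 2 * (b - c) ^ 3)
            + (U * M / T ^ ((3 : ℝ) / 2)) * (1 + M / N) ^ 2))) := by
  set A := 1 + C2m + C2 + C3 + C4 + CM + D0 + D1 + D2 with hAdef
  refine ⟨272 * A ^ 16, by positivity, ?_⟩
  intro a b c T M N U f g _ hT hM hN hU hf hg hbd hCM' hc hf₁
  have hA : 1 ≤ A := by linarith
  have bound {σ d : ℝ} (hσ : |σ| = 1) (hab : a < b) (hd : d ∈ Icc a b)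
      (hcd : 0 < σ * (d - c)) :=
    norm_integral_sub_stationary_iteratedDerivWithin_le hA hM hN hT hU hσ hab hf hg hc hd hcd
      (hCM'.trans (by gcongr; linarith)) hf₁
      (fun z hz => le_trans (by gcongr; linarith) (hbd z hz).1)
      (fun z hz => (hbd z hz).2.1.trans (by gcongr; linarith))
      (fun z hz => (hbd z hz).2.2.1.trans (by gcongr; linarith))
      (fun z hz => (hbd z hz).2.2.2.1.trans (by gcongr; linarith))
      (fun z hz => (hbd z hz).2.2.2.2.1.trans (by gcongr; linarith))
      (fun z hz => (hbd z hz).2.2.2.2.2.1.trans (by gcongr; linarith))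
      (fun z hz => (hbd z hz).2.2.2.2.2.2.trans (by gcongr; linarith))
  refine ⟨fun hca _ => ?_, fun hcb _ => ?_⟩
  · have hab : a < b := by linarith [hc.2]
    have key := bound (σ := -1) (by norm_num) hab (left_mem_Icc.2 hab.le) (by linarith)
    rw [show -1 * (a - c) = c - a by ring] at key
    refine le_trans (le_of_eq ?_) key
    rw [intervalIntegral.integral_symm, ← norm_neg]
    congr 1
    push_cast
    ring
  · have hab : a < b := by linarith [hc.1]
    have key := bound (σ := 1) (by norm_num) hab (right_mem_Icc.2 hab.le) (by linarith)
    rwa [ofReal_one, one_mul, one_mul] at key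
end
end

section
/- Suppose the real-valued functions f, g satisfy condition (M) on [a,b] with functions M(x), U(x) and constants C₂, C₂₋, C₄, D₀, D₁, D₂, δ, and set η := 3δ/C₂₋ (so η < 2). Let ε ∈ {−1, +1}, let x ∈ [a,b] be such that x + ε·M(x) ∈ J, and let r ∈ ℝ satisfy either f'(x) − r = 0 or sgn(f'(x) − r) = ε. Then |f'(x + ε·M(x)) − r| ≥ (1 − η/2)·M(x)·f''(x). -/
open Complex Filter Set

noncomputable section

/-- `fd f s n` is the `n`-th derivative of `f` within the set `s`. -/
def fd (f : ℝ → ℝ) (s : Set ℝ) (n : ℕ) : ℝ → ℝ := fun x => iteratedDerivWithin n f s x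

/-- The set `ℤ ∩ (f'(x) − f''(x), f'(x) + f''(x)) \ {f'(x)}` (derivatives within `s`). -/
def mSet (f : ℝ → ℝ) (s : Set ℝ) (x : ℝ) : Set ℤ :=
  {k : ℤ | (k : ℝ) ∈ Set.Ioo (fd f s 1 x - fd f s 2 x) (fd f s 1 x + fd f s 2 x) ∧
    (k : ℝ) ≠ fd f s 1 x}

open scoped Classical in
/-- `c(x)`: `0` if `mSet` at `x` is empty, `1` otherwise. -/
def cefun (f : ℝ → ℝ) (a b x : ℝ) : ℝ :=
  if mSet f (Set.Icc a b) x = ∅ then 0 else 1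

/-- The enlarged interval `J = [a − c(a)M(a), b + c(b)M(b)]`. -/
def Jset (f M : ℝ → ℝ) (a b : ℝ) : Set ℝ :=
  Set.Icc (a - cefun f a b a * M a) (b + cefun f a b b * M b)

/-- Condition (M) of the paper for the pair `f`, `g` on `[a,b]`, with auxiliary
functions `M`, `U` and constants `C₂, C₂₋, C₄, D₀, D₁, D₂, δ`. -/
structure ConditionM (f g M U : ℝ → ℝ) (a b : ℝ)
    (C2 C2m C4 D0 D1 D2 δ : ℝ) : Prop where
  hab : a < b
  M_pos : ∀ x ∈ Set.Icc a b, 0 < M x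
  U_pos : ∀ x ∈ Set.Icc a b, 0 < U x
  M_bdd : ∃ B, ∀ x ∈ Set.Icc a b, M x ≤ B
  U_bdd : ∃ B, ∀ x ∈ Set.Icc a b, U x ≤ B
  M_smooth : ContDiffOn ℝ 1 M (Set.Icc a b)
  U_smooth : ContDiffOn ℝ 1 U (Set.Icc a b)
  C2_pos : 0 < C2
  C2m_pos : 0 < C2m
  C4_pos : 0 < C4
  D0_pos : 0 < D0
  D1_pos : 0 < D1
  D2_pos : 0 < D2
  delta_pos : 0 < δ
  hI : max (M a) (M b) ≤ b - a
  hdelta : δ < 1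
  heta : 3 * δ / C2m < 2
  f_smooth : ContDiffOn ℝ 4 f (Jset f M a b)
  g_smooth : ContDiffOn ℝ 3 g (Jset f M a b)
  f''_pos : ∀ x ∈ Jset f M a b, 0 < fd f (Jset f M a b) 2 x
  f''_away : ∃ c > 0, ∀ x ∈ Jset f M a b, c ≤ fd f (Jset f M a b) 2 x
  hIV : ∀ x ∈ Set.Icc a b, ∀ z ∈ Set.Icc (x - M x) (x + M x) ∩ Jset f M a b,
    fd f (Jset f M a b) 2 x / C2m ≤ fd f (Jset f M a b) 2 z ∧
    fd f (Jset f M a b) 2 z ≤ C2 * fd f (Jset f M a b) 2 x ∧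
    |fd f (Jset f M a b) 3 z| ≤ (3 * δ / C2m) * fd f (Jset f M a b) 2 x / M x ∧
    |fd f (Jset f M a b) 4 z| ≤ (3 * δ / C2m) ^ 2 * C4 * fd f (Jset f M a b) 2 x / M x ^ 2 ∧
    |g z| ≤ D0 * U x ∧
    |derivWithin g (Jset f M a b) z| ≤ D1 * U x / M x ∧
    |iteratedDerivWithin 2 g (Jset f M a b) z| ≤ D2 * U x / M x ^ 2

/-- A one-sided second order Taylor bound on `[0, T]`. -/
theorem taylor_lower_bound {φ φ₁ φ₂ : ℝ → ℝ} {T K : ℝ} (hT : 0 ≤ T)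
    (h₁ : ∀ t ∈ Icc 0 T, HasDerivWithinAt φ (φ₁ t) (Icc 0 T) t)
    (h₂ : ∀ t ∈ Icc 0 T, HasDerivWithinAt φ₁ (φ₂ t) (Icc 0 T) t)
    (hK : ∀ t ∈ Icc 0 T, |φ₂ t| ≤ K) :
    φ₁ 0 * T - K * T ^ 2 / 2 ≤ φ T - φ 0 := by
  have h0 : (0 : ℝ) ∈ Icc 0 T := ⟨le_rfl, hT⟩
  have hlip : ∀ t ∈ Icc 0 T, |φ₁ t - φ₁ 0| ≤ K * t := fun t ht => by
    simpa [abs_of_nonneg ht.1] using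
      (convex_Icc 0 T).norm_image_sub_le_of_norm_hasDerivWithin_le h₂ hK h0 ht
  have hderiv : ∀ t ∈ Icc 0 T, HasDerivWithinAt (fun t => φ t - φ₁ 0 * t + K / 2 * t ^ 2)
      (φ₁ t - φ₁ 0 + K * t) (Icc 0 T) t := fun t ht => by
    have hlin := (hasDerivWithinAt_id t (Icc 0 T)).const_mul (φ₁ 0)
    have hsq := ((hasDerivWithinAt_id t (Icc 0 T)).pow 2).const_mul (K / 2)
    refine (((h₁ t ht).sub hlin).add hsq).congr_deriv ?_
    simp
    ring
  have hmono : MonotoneOn (fun t => φ t - φ₁ 0 * t + K / 2 * t ^ 2) (Icc 0 T) :=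
    monotoneOn_of_hasDerivWithinAt_nonneg (convex_Icc 0 T)
      (fun t ht => (hderiv t ht).continuousWithinAt)
      (fun t ht => (hderiv t (interior_subset ht)).mono interior_subset)
      (fun t ht => by linarith [(abs_le.mp (hlip t (interior_subset ht))).1])
  have := hmono h0 ⟨hT, le_rfl⟩ hT
  simp only at this
  linarith

theorem fd_hasDerivWithinAt {f : ℝ → ℝ} {s : Set ℝ} {m n : ℕ} (hf : ContDiffOn ℝ n f s)
    (hs : UniqueDiffOn ℝ s) (hmn : m < n) {y : ℝ} (hy : y ∈ s) :
    HasDerivWithinAt (fd f s m) (fd f s (m + 1) y) s y := by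
  have h := (hf.differentiableOn_iteratedDerivWithin (by exact_mod_cast hmn) hs y
    hy).hasDerivWithinAt
  rwa [← iteratedDerivWithin_succ] at h

theorem cefun_nonneg (f : ℝ → ℝ) (a b x : ℝ) : 0 ≤ cefun f a b x := by
  unfold cefun
  split_ifs <;> norm_num

theorem ConditionM.Icc_subset_Jset {f g M U : ℝ → ℝ} {a b C2 C2m C4 D0 D1 D2 δ : ℝ}
    (hM : ConditionM f g M U a b C2 C2m C4 D0 D1 D2 δ) : Icc a b ⊆ Jset f M a b := by
  have ha := mul_nonneg (cefun_nonneg f a b a) (hM.M_pos a ⟨le_rfl, hM.hab.le⟩).le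
  have hb := mul_nonneg (cefun_nonneg f a b b) (hM.M_pos b ⟨hM.hab.le, le_rfl⟩).le
  exact Icc_subset_Icc (by linarith) (by linarith)

theorem ConditionM.uniqueDiffOn_Jset {f g M U : ℝ → ℝ} {a b C2 C2m C4 D0 D1 D2 δ : ℝ}
    (hM : ConditionM f g M U a b C2 C2m C4 D0 D1 D2 δ) : UniqueDiffOn ℝ (Jset f M a b) := by
  have ha := (hM.Icc_subset_Jset ⟨le_rfl, hM.hab.le⟩).1
  have hb := (hM.Icc_subset_Jset ⟨hM.hab.le, le_rfl⟩).2
  exact uniqueDiffOn_Icc (by linarith [hM.hab])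

/-- Proposition: under condition (M), if `ε = ±1` and either `f'(x) = r` or
`sgn(f'(x) − r) = ε`, then `|f'(x + ε·M(x)) − r| ≥ (1 − η/2)·M(x)·f''(x)`,
where `η = 3δ/C₂₋`. -/
theorem stmt11 (f g M U : ℝ → ℝ) (a b : ℝ) (C2 C2m C4 D0 D1 D2 δ : ℝ)
    (hM : ConditionM f g M U a b C2 C2m C4 D0 D1 D2 δ)
    (ε : ℝ) (hε : ε = -1 ∨ ε = 1)
    (x : ℝ) (hx : x ∈ Set.Icc a b)
    (hxJ : x + ε * M x ∈ Jset f M a b)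
    (r : ℝ)
    (hr : fd f (Jset f M a b) 1 x - r = 0 ∨ Real.sign (fd f (Jset f M a b) 1 x - r) = ε) :
    (1 - (3 * δ / C2m) / 2) * M x * fd f (Jset f M a b) 2 x ≤
      |fd f (Jset f M a b) 1 (x + ε * M x) - r| := by
  have hMx := hM.M_pos x hx
  have hxJ' := hM.Icc_subset_Jset hx
  have hsq : ε * ε = 1 := by rcases hε with rfl | rfl <;> norm_num
  have hrε : 0 ≤ ε * (fd f (Jset f M a b) 1 x - r) := by
    rcases hr with h | h
    · simp [h]
    · rw [← h, mul_comm]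
      rcases lt_trichotomy (fd f (Jset f M a b) 1 x - r) 0 with h' | h' | h'
      · rw [Real.sign_of_neg h']; linarith
      · simp [h']
      · rw [Real.sign_of_pos h']; linarith
  have hmapsJ : MapsTo (fun t => x + ε * t) (Icc 0 (M x)) (Jset f M a b) := by
    intro t ht
    obtain ⟨h₁, h₂⟩ := hxJ
    obtain ⟨h₃, h₄⟩ := hxJ'
    obtain ⟨h₅, h₆⟩ := ht
    rcases hε with rfl | rfl <;> constructor <;> dsimp only <;> linarith
  have hmapsI : MapsTo (fun t => x + ε * t) (Icc 0 (M x)) (Icc (x - M x) (x + M x)) := by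
    intro t ht
    obtain ⟨h₅, h₆⟩ := ht
    rcases hε with rfl | rfl <;> constructor <;> dsimp only <;> linarith
  have hline : ∀ t, HasDerivWithinAt (fun t => x + ε * t) ε (Icc 0 (M x)) t := fun t => by
    simpa using ((hasDerivWithinAt_id t (Icc 0 (M x))).const_mul ε).const_add x
  have hderiv : ∀ m < 4, ∀ t ∈ Icc 0 (M x),
      HasDerivWithinAt (fun t => fd f (Jset f M a b) m (x + ε * t))
        (fd f (Jset f M a b) (m + 1) (x + ε * t) * ε) (Icc 0 (M x)) t := fun m hm t ht =>
    (fd_hasDerivWithinAt (n := 4) hM.f_smooth hM.uniqueDiffOn_Jset hm (hmapsJ ht)).comp t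
      (hline t) hmapsJ
  have hlower := taylor_lower_bound (K := 3 * δ / C2m * fd f (Jset f M a b) 2 x / M x)
    (φ := fun t => ε * fd f (Jset f M a b) 1 (x + ε * t))
    (φ₁ := fun t => fd f (Jset f M a b) 2 (x + ε * t)) hMx.le
    (fun t ht => ((hderiv 1 (by norm_num) t ht).const_mul ε).congr_deriv (by
      linear_combination fd f (Jset f M a b) 2 (x + ε * t) * hsq))
    (fun t ht => hderiv 2 (by norm_num) t ht)
    (fun t ht => by
      have habs : |ε| = 1 := by rcases hε with rfl | rfl <;> norm_num
      rw [abs_mul, habs, mul_one]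
      exact (hM.hIV x hx _ ⟨hmapsI ht, hmapsJ ht⟩).2.2.1)
  have hconst : 3 * δ / C2m * fd f (Jset f M a b) 2 x / M x * M x ^ 2 =
      3 * δ / C2m * fd f (Jset f M a b) 2 x * M x := by
    rw [div_mul_eq_mul_div, div_eq_iff hMx.ne']
    ring
  simp only [mul_zero, add_zero, hconst] at hlower
  calc (1 - (3 * δ / C2m) / 2) * M x * fd f (Jset f M a b) 2 x
      ≤ ε * (fd f (Jset f M a b) 1 (x + ε * M x) - r) := by linarith
    _ ≤ |fd f (Jset f M a b) 1 (x + ε * M x) - r| := by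
      rcases hε with rfl | rfl
      · rw [neg_one_mul]; exact neg_le_abs _
      · rw [one_mul]; exact le_abs_self _
end
end

section
/- Let G be a real-valued differentiable function on [a,b] with G' integrable, and let F be a real-valued differentiable function on [a,b] with F([a,b]) = [α,β]. Assume F has only finitely many local extrema in (a,b), and that none of the values F(a), F(b), and F(x) for x a local extremum of F in (a,b) is an integer. Then there is an absolute constant C such that | Σ_{n∈ℤ, α≤n≤β} Σ_{x∈F^{-1}(n)} G(x) − ∫_a^b G(y)·|F'(y)| dy | ≤ C·( ∫_a^b |G'(y)| dy + |s(F(a))·G(a)| + |s(F(b))·G(b)| + Σ_{x local extremum of F in (a,b)} |s(F(x))·G(x)| ), where the inner sum Σ_{x∈F^{-1}(n)} G(x) runs over all (finitely many) solutions x ∈ [a,b] of F(x) = n. -/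
open Filter Set

noncomputable section

/-- `s(x) = {x} − 1/2`, the sawtooth function. -/
def saw (x : ℝ) : ℝ := Int.fract x - 1/2

open MeasureTheory intervalIntegral in
/-- Integrating a derivative against the indicator of `[x, ∞)`. -/
lemma integral_deriv_mul_indicator_Ici {c d x : ℝ} {G G' : ℝ → ℝ} (hx : x ∈ Icc c d)
    (hGc : ContinuousOn G (Icc c d)) (hG : ∀ y ∈ Ioo c d, HasDerivAt G (G' y) y)
    (hGi : IntervalIntegrable G' volume c d) :
    IntervalIntegrable (fun y => G' y * if x ≤ y then 1 else 0) volume c d ∧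
      ∫ y in c..d, G' y * (if x ≤ y then 1 else 0) = G d - G x := by
  obtain ⟨hcx, hxd⟩ := hx
  have e1 : EqOn (fun _ => (0 : ℝ)) (fun y => G' y * if x ≤ y then 1 else 0) (Ioo c x) := by
    intro y hy
    simp [hy.2]
  have e2 : EqOn G' (fun y => G' y * if x ≤ y then 1 else 0) (Ioo x d) := by
    intro y hy
    simp [hy.1.le]
  have i2 : IntervalIntegrable G' volume x d := by
    apply hGi.mono_set
    rw [uIcc_of_le hxd, uIcc_of_le (hcx.trans hxd)]
    exact Icc_subset_Icc_left hcx
  have j1 : IntervalIntegrable (fun y => G' y * if x ≤ y then 1 else 0) volume c x :=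
    (intervalIntegrable_const (c := (0 : ℝ))).congr_uIoo (by rwa [uIoo_of_le hcx])
  have j2 : IntervalIntegrable (fun y => G' y * if x ≤ y then 1 else 0) volume x d :=
    i2.congr_uIoo (by rwa [uIoo_of_le hxd])
  refine ⟨j1.trans j2, ?_⟩
  rw [← integral_add_adjacent_intervals j1 j2, ← integral_congr_Ioo_of_le hcx e1,
    ← integral_congr_Ioo_of_le hxd e2,
    integral_eq_sub_of_hasDerivAt_of_le hxd (hGc.mono (Icc_subset_Icc_left hcx))
      (fun y hy => hG y ⟨hcx.trans_lt hy.1, hy.2⟩) i2]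
  simp

/-- A strictly increasing continuous function with `F c ∉ ℤ` takes exactly `⌊F y⌋ - ⌊F c⌋`
integer values on `[c, y]`. -/
lemma StrictMonoOn.card_integer_values {c d y : ℝ} {F : ℝ → ℝ} {T : Finset ℝ}
    (hF : StrictMonoOn F (Icc c d)) (hFc : ContinuousOn F (Icc c d))
    (hT : ∀ x, x ∈ T ↔ x ∈ Icc c d ∧ ∃ k : ℤ, F x = k)
    (hc : ¬ ∃ k : ℤ, F c = k) (hy : y ∈ Icc c d) :
    ((T.filter (· ≤ y)).card : ℤ) = ⌊F y⌋ - ⌊F c⌋ := by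
  have hcd : c ≤ d := hy.1.trans hy.2
  have hcm : c ∈ Icc c d := left_mem_Icc.2 hcd
  have hle : ⌊F c⌋ ≤ ⌊F y⌋ := Int.floor_mono (hF.monotoneOn hcm hy hy.1)
  have key : (T.filter (· ≤ y)).card = (Finset.Ioc ⌊F c⌋ ⌊F y⌋).card := by
    refine Finset.card_nbij (fun x => ⌊F x⌋) ?_ ?_ ?_
    · intro x hx
      simp only [Finset.coe_filter, mem_ofPred_eq, hT] at hx
      obtain ⟨⟨hx, k, hk⟩, hxy⟩ := hx
      have h1 : F c < F x := by
        refine lt_of_le_of_ne (hF.monotoneOn hcm hx hx.1) fun h => hc ⟨k, h.trans hk⟩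
      have h2 : F x ≤ F y := hF.monotoneOn hx hy hxy
      simp only [Finset.coe_Ioc, mem_Ioc]
      refine ⟨?_, Int.floor_mono h2⟩
      rw [hk, Int.floor_intCast, Int.floor_lt, ← hk]
      exact h1
    · intro x hx z hz hxz
      simp only [Finset.coe_filter, mem_ofPred_eq, hT] at hx hz
      obtain ⟨⟨hx, k, hk⟩, -⟩ := hx
      obtain ⟨⟨hz, l, hl⟩, -⟩ := hz
      apply hF.injOn hx hz
      simp only [hk, hl, Int.floor_intCast] at hxz
      rw [hk, hl, hxz]
    · intro k hk
      simp only [Finset.coe_Ioc, mem_Ioc] at hk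
      have hk1 : F c ≤ k := (Int.floor_lt.1 hk.1).le
      have hk2 : (k : ℝ) ≤ F y := Int.le_floor.1 hk.2
      obtain ⟨x, hx, hxk⟩ :=
        intermediate_value_Icc hy.1 (hFc.mono (Icc_subset_Icc_right hy.2)) ⟨hk1, hk2⟩
      refine ⟨x, ?_, by simp [hxk]⟩
      simp only [Finset.coe_filter, mem_ofPred_eq, hT]
      exact ⟨⟨⟨hx.1, hx.2.trans hy.2⟩, k, hxk⟩, hx.2⟩
  rw [key, Int.card_Ioc]
  omega

lemma abs_saw_le (x : ℝ) : |saw x| ≤ 1 := by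
  have h1 := Int.fract_nonneg x
  have h2 := Int.fract_lt_one x
  rw [saw, abs_le]
  constructor <;> linarith

lemma saw_neg {x : ℝ} (hx : ¬ ∃ k : ℤ, x = k) : saw (-x) = -saw x := by
  have : Int.fract x ≠ 0 := fun h => by
    obtain ⟨k, hk⟩ := Int.fract_eq_zero_iff.1 h
    exact hx ⟨k, hk.symm⟩
  rw [saw, saw, Int.fract_neg this]
  ring

open MeasureTheory intervalIntegral in
/-- The summation formula on an interval where `F` is strictly increasing. -/
lemma StrictMonoOn.abs_sum_integer_values_sub_integral_le {c d : ℝ} {F F' G G' : ℝ → ℝ}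
    {T : Finset ℝ} (hcd : c ≤ d)
    (hGc : ContinuousOn G (Icc c d)) (hG : ∀ y ∈ Ioo c d, HasDerivAt G (G' y) y)
    (hGi : IntervalIntegrable G' volume c d)
    (hFc : ContinuousOn F (Icc c d)) (hF' : ∀ y ∈ Ioo c d, HasDerivAt F (F' y) y)
    (hF : StrictMonoOn F (Icc c d))
    (hT : ∀ x, x ∈ T ↔ x ∈ Icc c d ∧ ∃ k : ℤ, F x = k)
    (hc : ¬ ∃ k : ℤ, F c = k) :
    IntervalIntegrable (fun y => G y * |F' y|) volume c d ∧
      |(∑ x ∈ T, G x) - (∫ y in c..d, G y * |F' y|)| ≤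
        (∫ y in c..d, |G' y|) + |saw (F c) * G c| + |saw (F d) * G d| := by
  have hpos : ∀ y ∈ Ioo c d, 0 ≤ F' y := by
    intro y hy
    have h := (hF.monotoneOn.mono Ioo_subset_Icc_self).derivWithin_nonneg (x := y)
    rwa [(hF' y hy).hasDerivWithinAt.derivWithin (isOpen_Ioo.uniqueDiffWithinAt hy)] at h
  have hFi : IntervalIntegrable F' volume c d := by
    apply intervalIntegrable_deriv_of_nonneg (g := F)
    · rwa [uIcc_of_le hcd]
    · rwa [min_eq_left hcd, max_eq_right hcd]
    · rwa [min_eq_left hcd, max_eq_right hcd]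
  have hGF' : IntervalIntegrable (fun y => G y * F' y) volume c d :=
    hFi.continuousOn_mul (by rwa [uIcc_of_le hcd])
  have hG'F : IntervalIntegrable (fun y => G' y * F y) volume c d :=
    hGi.mul_continuousOn (by rwa [uIcc_of_le hcd])
  have eabs : EqOn (fun y => G y * F' y) (fun y => G y * |F' y|) (Ioo c d) := by
    intro y hy
    simp only [abs_of_nonneg (hpos y hy)]
  refine ⟨hGF'.congr_uIoo (by rwa [uIoo_of_le hcd]), ?_⟩
  rw [← integral_congr_Ioo_of_le hcd eabs]
  have hparts : (∫ y in c..d, G' y * F y) + ∫ y in c..d, G y * F' y = G d * F d - G c * F c := by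
    rw [← integral_add hG'F hGF']
    exact integral_eq_sub_of_hasDerivAt_of_le hcd (hGc.mul hFc)
      (fun y hy => (hG y hy).mul (hF' y hy)) (hG'F.add hGF')
  have hGint : ∫ y in c..d, G' y = G d - G c :=
    integral_eq_sub_of_hasDerivAt_of_le hcd hGc hG hGi
  have hcount : ∀ y ∈ Icc c d,
      ∑ x ∈ T, G' y * (if x ≤ y then 1 else 0) = G' y * (⌊F y⌋ - ⌊F c⌋) := by
    intro y hy
    rw [← Finset.mul_sum, Finset.sum_boole]
    have := hF.card_integer_values hFc hT hc hy
    rw [← Int.cast_natCast, this, Int.cast_sub]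
  have hI := fun x (hx : x ∈ T) => integral_deriv_mul_indicator_Ici ((hT x).1 hx).1 hGc hG hGi
  have hsi : IntervalIntegrable (fun y => ∑ x ∈ T, G' y * (if x ≤ y then 1 else 0)) volume c d := by
    have := IntervalIntegrable.sum T fun x hx => (hI x hx).1
    exact this.congr fun y _ => by simp only [Finset.sum_apply]
  have eflo : EqOn (fun y => ∑ x ∈ T, G' y * (if x ≤ y then 1 else 0))
      (fun y => G' y * (⌊F y⌋ - ⌊F c⌋)) (Ioo c d) :=
    fun y hy => hcount y (Ioo_subset_Icc_self hy)
  have hflo : ∑ x ∈ T, (G d - G x) = ∫ y in c..d, G' y * (⌊F y⌋ - ⌊F c⌋) := by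
    rw [← integral_congr_Ioo_of_le hcd eflo, integral_finsetSum fun x hx => (hI x hx).1]
    exact Finset.sum_congr rfl fun x hx => (hI x hx).2.symm
  have hfli : IntervalIntegrable (fun y => G' y * (⌊F y⌋ - ⌊F c⌋)) volume c d :=
    hsi.congr_uIoo (by rwa [uIoo_of_le hcd])
  have hcard : (T.card : ℝ) = ⌊F d⌋ - ⌊F c⌋ := by
    have h := hF.card_integer_values hFc hT hc (right_mem_Icc.2 hcd)
    rw [Finset.filter_true_of_mem fun x hx => ((hT x).1 hx).1.2] at h
    exact_mod_cast h
  rw [Finset.sum_sub_distrib, Finset.sum_const, nsmul_eq_mul, hcard] at hflo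
  have hsaw : ∫ y in c..d, G' y * saw (F y) =
      (∫ y in c..d, G' y * F y) - (∫ y in c..d, G' y * (⌊F y⌋ - ⌊F c⌋))
        - (⌊F c⌋ + 1/2) * (G d - G c) := by
    rw [← hGint, ← intervalIntegral.integral_const_mul, ← integral_sub hG'F hfli,
      ← integral_sub (hG'F.sub hfli) (hGi.const_mul _)]
    congr 1
    ext y
    simp only [saw, Int.fract]
    ring
  have hid : ∑ x ∈ T, G x - ∫ y in c..d, G y * F' y =
      (∫ y in c..d, G' y * saw (F y)) + saw (F c) * G c - saw (F d) * G d := by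
    rw [hsaw]
    simp only [saw, Int.fract]
    linarith
  have hb : |∫ y in c..d, G' y * saw (F y)| ≤ ∫ y in c..d, |G' y| := by
    rw [← Real.norm_eq_abs]
    refine norm_integral_le_of_norm_le hcd (ae_of_all _ fun y _ => ?_) hGi.abs
    rw [Real.norm_eq_abs, abs_mul]
    exact mul_le_of_le_one_right (abs_nonneg _) (abs_saw_le _)
  rw [hid]
  calc _ ≤ |(∫ y in c..d, G' y * saw (F y)) + saw (F c) * G c| + |saw (F d) * G d| := abs_sub _ _
    _ ≤ _ := by
      gcongr
      exact (abs_add_le _ _).trans (by gcongr)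

/-- A continuous function without local extrema in the open interval is strictly monotone or
strictly antitone. -/
lemma ContinuousOn.strictMonoOn_or_strictAntiOn_of_not_isLocalExtr {c d : ℝ} {F : ℝ → ℝ}
    (hcd : c ≤ d) (hFc : ContinuousOn F (Icc c d)) (h : ∀ x ∈ Ioo c d, ¬ IsLocalExtr F x) :
    StrictMonoOn F (Icc c d) ∨ StrictAntiOn F (Icc c d) := by
  apply hFc.strictMonoOn_of_injOn_Icc' hcd
  have key : ∀ x ∈ Icc c d, ∀ y ∈ Icc c d, x < y → F x ≠ F y := by
    intro x hx y hy hxy hF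
    obtain ⟨z, hz, hz'⟩ := exists_isLocalExtr_Ioo hxy (hFc.mono (Icc_subset_Icc hx.1 hy.2)) hF
    exact h z ⟨hx.1.trans_lt hz.1, hz.2.trans_le hy.2⟩ hz'
  intro x hx y hy hF
  by_contra hne
  rcases lt_or_gt_of_ne hne with hlt | hlt
  · exact key x hx y hy hlt hF
  · exact key y hy x hx hlt hF.symm

open MeasureTheory intervalIntegral in
/-- The summation formula on an interval where `F` has a prescribed finite set `E` of local
extrema, by induction on the size of `E`. -/
lemma abs_sum_integer_values_sub_integral_le (E : Finset ℝ) :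
    ∀ {c d : ℝ} {F F' G G' : ℝ → ℝ} {T : Finset ℝ}, c ≤ d →
      ContinuousOn G (Icc c d) → (∀ y ∈ Ioo c d, HasDerivAt G (G' y) y) →
      IntervalIntegrable G' volume c d →
      ContinuousOn F (Icc c d) → (∀ y ∈ Ioo c d, HasDerivAt F (F' y) y) →
      (∀ x, x ∈ E ↔ x ∈ Ioo c d ∧ IsLocalExtr F x) →
      (∀ x, x ∈ T ↔ x ∈ Icc c d ∧ ∃ k : ℤ, F x = k) →
      (¬ ∃ k : ℤ, F c = k) → (¬ ∃ k : ℤ, F d = k) → (∀ x ∈ E, ¬ ∃ k : ℤ, F x = k) →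
      IntervalIntegrable (fun y => G y * |F' y|) volume c d ∧
        |(∑ x ∈ T, G x) - (∫ y in c..d, G y * |F' y|)| ≤
          (∫ y in c..d, |G' y|) + |saw (F c) * G c| + |saw (F d) * G d|
            + 2 * ∑ x ∈ E, |saw (F x) * G x| := by
  induction E using Finset.strongInduction with
  | H E ih =>
  intro c d F F' G G' T hcd hGc hG hGi hFc hF hE hT hc hd hEi
  rcases E.eq_empty_or_nonempty with rfl | ⟨e, he⟩
  · simp only [Finset.sum_empty, mul_zero, add_zero]
    rcases hFc.strictMonoOn_or_strictAntiOn_of_not_isLocalExtr hcd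
      (fun x hx hxe => by simpa using (hE x).2 ⟨hx, hxe⟩) with hm | hm
    · exact hm.abs_sum_integer_values_sub_integral_le hcd hGc hG hGi hFc hF hT hc
    · have neg_int : ∀ r : ℝ, (∃ k : ℤ, -r = k) ↔ ∃ k : ℤ, r = k := fun r =>
        ⟨fun ⟨k, hk⟩ => ⟨-k, by push_cast; linarith⟩, fun ⟨k, hk⟩ => ⟨-k, by push_cast; linarith⟩⟩
      have := StrictMonoOn.abs_sum_integer_values_sub_integral_le (F := fun x => -F x)
        (F' := fun x => -F' x) (T := T) hcd hGc hG hGi hFc.neg (fun y hy => (hF y hy).neg)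
        hm.neg (fun x => by rw [neg_int, hT]) (by rwa [neg_int])
      simpa only [abs_neg, saw_neg hc, saw_neg hd, neg_mul] using this
  · obtain ⟨⟨hce, hed⟩, hex⟩ := (hE e).1 he
    have hei := hEi e he
    have s1 : Icc c e ⊆ Icc c d := Icc_subset_Icc_right hed.le
    have s2 : Icc e d ⊆ Icc c d := Icc_subset_Icc_left hce.le
    have o1 : Ioo c e ⊆ Ioo c d := Ioo_subset_Ioo_right hed.le
    have o2 : Ioo e d ⊆ Ioo c d := Ioo_subset_Ioo_left hce.le
    have g1 : IntervalIntegrable G' volume c e :=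
      hGi.mono_set (by rwa [uIcc_of_le hce.le, uIcc_of_le hcd])
    have g2 : IntervalIntegrable G' volume e d :=
      hGi.mono_set (by rwa [uIcc_of_le hed.le, uIcc_of_le hcd])
    have f1 : E.filter (· < e) ⊂ E :=
      Finset.filter_ssubset.2 ⟨e, he, lt_irrefl _⟩
    have f2 : E.filter (e < ·) ⊂ E :=
      Finset.filter_ssubset.2 ⟨e, he, lt_irrefl _⟩
    obtain ⟨i1, b1⟩ := ih _ f1 (T := T.filter (· < e)) hce.le (hGc.mono s1)
      (fun y hy => hG y (o1 hy)) g1 (hFc.mono s1) (fun y hy => hF y (o1 hy))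
      (fun x => by
        simp only [Finset.mem_filter, hE, mem_Ioo]
        exact ⟨fun h => ⟨⟨h.1.1.1, h.2⟩, h.1.2⟩,
          fun h => ⟨⟨⟨h.1.1, h.1.2.trans hed⟩, h.2⟩, h.1.2⟩⟩)
      (fun x => by
        simp only [Finset.mem_filter, hT, mem_Icc]
        exact ⟨fun h => ⟨⟨h.1.1.1, h.2.le⟩, h.1.2⟩,
          fun h => ⟨⟨⟨h.1.1, h.1.2.trans hed.le⟩, h.2⟩,
            lt_of_le_of_ne h.1.2 fun hxe => hei (hxe ▸ h.2)⟩⟩)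
      hc hei (fun x hx => hEi x (Finset.mem_of_mem_filter x hx))
    obtain ⟨i2, b2⟩ := ih _ f2 (T := T.filter (¬ · < e)) hed.le (hGc.mono s2)
      (fun y hy => hG y (o2 hy)) g2 (hFc.mono s2) (fun y hy => hF y (o2 hy))
      (fun x => by
        simp only [Finset.mem_filter, hE, mem_Ioo]
        exact ⟨fun h => ⟨⟨h.2, h.1.1.2⟩, h.1.2⟩,
          fun h => ⟨⟨⟨hce.trans h.1.1, h.1.2⟩, h.2⟩, h.1.1⟩⟩)
      (fun x => by
        simp only [Finset.mem_filter, hT, mem_Icc, not_lt]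
        exact ⟨fun h => ⟨⟨h.2, h.1.1.2⟩, h.1.2⟩,
          fun h => ⟨⟨⟨hce.le.trans h.1.1, h.1.2⟩, h.2⟩, h.1.1⟩⟩)
      hei hd (fun x hx => hEi x (Finset.mem_of_mem_filter x hx))
    refine ⟨i1.trans i2, ?_⟩
    have hEsum : ∑ x ∈ E, |saw (F x) * G x| = ∑ x ∈ E.filter (· < e), |saw (F x) * G x|
        + |saw (F e) * G e| + ∑ x ∈ E.filter (e < ·), |saw (F x) * G x| := by
      rw [← Finset.sum_filter_add_sum_filter_not E (· < e), add_assoc]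
      congr 1
      have : E.filter (¬ · < e) = insert e (E.filter (e < ·)) := by
        ext x
        simp only [Finset.mem_filter, Finset.mem_insert, not_lt]
        constructor
        · rintro ⟨hx, hle⟩
          exact hle.eq_or_lt.imp Eq.symm fun h => ⟨hx, h⟩
        · rintro (rfl | ⟨hx, hlt⟩)
          exacts [⟨he, le_rfl⟩, ⟨hx, hlt.le⟩]
      rw [this, Finset.sum_insert (by simp)]
    rw [← Finset.sum_filter_add_sum_filter_not T (· < e), hEsum,
      ← integral_add_adjacent_intervals i1 i2, ← integral_add_adjacent_intervals g1.abs g2.abs,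
      add_sub_add_comm]
    refine (abs_add_le _ _).trans ?_
    linarith

/-- Euler–Maclaurin type summation over level sets: if `G` is differentiable on
`[a,b]` with integrable derivative, `F` is differentiable with `F([a,b]) = [α,β]`,
`F` has finitely many local extrema in `(a,b)`, and none of `F(a)`, `F(b)`, nor the
values of `F` at its local extrema is an integer, then
`Σ_{α≤n≤β} Σ_{x∈F⁻¹(n)} G(x)` equals `∫_a^b G|F'|` up to an absolutely bounded
combination of `∫|G'|` and sawtooth boundary terms. -/
theorem stmt13 :
    ∃ C : ℝ, ∀ (a b α β : ℝ) (G F : ℝ → ℝ), a ≤ b →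
      DifferentiableOn ℝ G (Set.Icc a b) →
      IntervalIntegrable (derivWithin G (Set.Icc a b)) MeasureTheory.volume a b →
      DifferentiableOn ℝ F (Set.Icc a b) →
      F '' Set.Icc a b = Set.Icc α β →
      ∀ hE : {x ∈ Set.Ioo a b | IsLocalExtr F x}.Finite,
      (¬ ∃ k : ℤ, F a = (k : ℝ)) →
      (¬ ∃ k : ℤ, F b = (k : ℝ)) →
      (∀ x ∈ {x ∈ Set.Ioo a b | IsLocalExtr F x}, ¬ ∃ k : ℤ, F x = (k : ℝ)) →
      ∀ hfib : ∀ n : ℤ, {x ∈ Set.Icc a b | F x = (n : ℝ)}.Finite,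
      abs ((∑ n ∈ Finset.Icc ⌈α⌉ ⌊β⌋, ∑ x ∈ (hfib n).toFinset, G x)
          - ∫ y in a..b, G y * |derivWithin F (Set.Icc a b) y|)
      ≤ C * ((∫ y in a..b, |derivWithin G (Set.Icc a b) y|)
          + |saw (F a) * G a| + |saw (F b) * G b|
          + ∑ x ∈ hE.toFinset, |saw (F x) * G x|) := by
  refine ⟨2, ?_⟩
  intro a b α β G F hab hG hGi hF him hE ha hb hEi hfib
  have hderiv : ∀ {H : ℝ → ℝ}, DifferentiableOn ℝ H (Icc a b) →
      ∀ y ∈ Ioo a b, HasDerivAt H (derivWithin H (Icc a b) y) y := fun hH y hy =>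
    (hH y (Ioo_subset_Icc_self hy)).hasDerivWithinAt.hasDerivAt (Icc_mem_nhds hy.1 hy.2)
  have hsum : ∑ n ∈ Finset.Icc ⌈α⌉ ⌊β⌋, ∑ x ∈ (hfib n).toFinset, G x =
      ∑ x ∈ (Finset.Icc ⌈α⌉ ⌊β⌋).biUnion fun n => (hfib n).toFinset, G x := by
    refine (Finset.sum_biUnion fun m _ n _ hmn => Finset.disjoint_left.2 fun x hm hn => ?_).symm
    simp only [Set.Finite.mem_toFinset, mem_ofPred_eq] at hm hn
    exact hmn (by exact_mod_cast hm.2.symm.trans hn.2)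
  rw [hsum]
  obtain ⟨-, h⟩ := abs_sum_integer_values_sub_integral_le hE.toFinset (F := F) (G := G)
    (T := (Finset.Icc ⌈α⌉ ⌊β⌋).biUnion fun n => (hfib n).toFinset) hab hG.continuousOn
    (hderiv hG) hGi hF.continuousOn (hderiv hF) (fun x => by simp)
    (fun x => by
      simp only [Finset.mem_biUnion, Finset.mem_Icc, Set.Finite.mem_toFinset, mem_ofPred_eq]
      constructor
      · rintro ⟨n, -, hx, hn⟩
        exact ⟨hx, n, hn⟩
      · rintro ⟨hx, n, hn⟩
        have hm : F x ∈ Icc α β := him ▸ mem_image_of_mem F hx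
        rw [hn] at hm
        exact ⟨n, ⟨Int.ceil_le.2 hm.1, Int.le_floor.2 hm.2⟩, hx, hn⟩)
    ha hb (fun x hx => hEi x (hE.mem_toFinset.1 hx))
  refine h.trans ?_
  have h1 : 0 ≤ ∫ y in a..b, |derivWithin G (Icc a b) y| :=
    intervalIntegral.integral_nonneg hab fun y _ => abs_nonneg _
  have h2 := abs_nonneg (saw (F a) * G a)
  have h3 := abs_nonneg (saw (F b) * G b)
  linarith
end
end

section
/- Let a' < b' be real numbers, and let f be four times continuously differentiable and g three times continuously differentiable real-valued functions on [a', b'], with f''(x) > 0 for all x ∈ [a', b']. Define H := g·f''' + 3·g'·f'' and G := 12·g·g''·(f'')². (i) Suppose g'' ≡ 0 on (a', b'), g has no zeros on [a', b'], and H(x) ≠ 0 for all x ∈ (a', b'). Then the function |W₀'(x)| + |W₀(x)·r₀'(x)| is integrable on (a', b'), where W₀ := −H²·f'''/(27·g·(f'')⁵) and r₀ := f' − 3·g·(f'')²/H. (ii) Suppose g has no zeros on [a', b'], G(x) ≠ 0 and H(x)² − G(x) > 0 for all x ∈ (a', b'), and H² − G does not tend to 0 at a' or at b' (its liminf at each endpoint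 is positive). Then the function |W₊'(x)| + |W₋'(x)| + |W₊(x)·r₊'(x)| + |W₋(x)·r₋'(x)| is integrable on (a', b'), where W_± := (2g'')²·g'/(H ± √(H²−G))² − (2g'')³·f''·g/(H ± √(H²−G))³ and r_± := f' − (H ± √(H²−G))/(2g''). -/
open Complex Filter Set

noncomputable section

/-- `H = g f''' + 3 g' f''` (derivatives within `s`). -/
def Hf (f g : ℝ → ℝ) (s : Set ℝ) (x : ℝ) : ℝ :=
  g x * iteratedDerivWithin 3 f s x + 3 * derivWithin g s x * iteratedDerivWithin 2 f s x

/-- `G = 12 g g'' (f'')²` (derivatives within `s`). -/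
def Gf (f g : ℝ → ℝ) (s : Set ℝ) (x : ℝ) : ℝ :=
  12 * g x * iteratedDerivWithin 2 g s x * (iteratedDerivWithin 2 f s x) ^ 2

/-- `W₀ = −H² f''' / (27 g (f'')⁵)`. -/
def W0f (f g : ℝ → ℝ) (s : Set ℝ) (x : ℝ) : ℝ :=
  -(Hf f g s x ^ 2 * iteratedDerivWithin 3 f s x) /
    (27 * g x * (iteratedDerivWithin 2 f s x) ^ 5)

/-- `r₀ = f' − 3 g (f'')² / H`. -/
def r0f (f g : ℝ → ℝ) (s : Set ℝ) (x : ℝ) : ℝ :=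
  iteratedDerivWithin 1 f s x - 3 * g x * (iteratedDerivWithin 2 f s x) ^ 2 / Hf f g s x

/-- `W_± = (2g'')² g' / (H ± √(H²−G))² − (2g'')³ f'' g / (H ± √(H²−G))³`,
where `σ = ±1` selects the sign. -/
def Wpmf (σ : ℝ) (f g : ℝ → ℝ) (s : Set ℝ) (x : ℝ) : ℝ :=
  (2 * iteratedDerivWithin 2 g s x) ^ 2 * derivWithin g s x /
      (Hf f g s x + σ * Real.sqrt (Hf f g s x ^ 2 - Gf f g s x)) ^ 2
    - (2 * iteratedDerivWithin 2 g s x) ^ 3 *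
        (iteratedDerivWithin 2 f s x * g x) /
      (Hf f g s x + σ * Real.sqrt (Hf f g s x ^ 2 - Gf f g s x)) ^ 3

/-- `r_± = f' − (H ± √(H²−G))/(2g'')`, where `σ = ±1` selects the sign. -/
def rpmf (σ : ℝ) (f g : ℝ → ℝ) (s : Set ℝ) (x : ℝ) : ℝ :=
  iteratedDerivWithin 1 f s x -
    (Hf f g s x + σ * Real.sqrt (Hf f g s x ^ 2 - Gf f g s x)) /
      (2 * iteratedDerivWithin 2 g s x)

open MeasureTheory Topology
open scoped ContDiff

theorem ContDiffOn.one_iteratedDerivWithin {f : ℝ → ℝ} {s : Set ℝ} {n : ℕ∞ω} {k : ℕ}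
    (hf : ContDiffOn ℝ n f s) (hs : UniqueDiffOn ℝ s) (hkn : (k : ℕ∞ω) + 1 ≤ n) :
    ContDiffOn ℝ 1 (iteratedDerivWithin k f s) s :=
  ((contDiffOn_nat_succ_iff_contDiffOn_one_iteratedDerivWithin hs).1 (hf.of_le hkn)).2

theorem integrableOn_Ioo_of_continuousOn_Icc_of_eqOn {a b : ℝ} {h k : ℝ → ℝ}
    (hk : ContinuousOn k (Icc a b)) (heq : EqOn h k (Ioo a b)) :
    IntegrableOn h (Ioo a b) volume :=
  (hk.integrableOn_Icc.mono_set Ioo_subset_Icc_self).congr_fun heq.symm measurableSet_Ioo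

/-- If `W = u² P` and `r = A - 1 / u` with `u`, `P`, `A` continuously differentiable up to the
boundary, then `W'` and `W r'` are integrable, even if `u` vanishes at an endpoint: the pole of
`r'` is cancelled by `W`. -/
theorem integrableOn_abs_deriv_add_abs_mul_deriv {a b : ℝ} (hab : a < b) {u P A W r : ℝ → ℝ}
    (hu : ContDiffOn ℝ 1 u (Icc a b)) (hP : ContDiffOn ℝ 1 P (Icc a b))
    (hA : ContDiffOn ℝ 1 A (Icc a b)) (hu0 : ∀ x ∈ Ioo a b, u x ≠ 0)
    (hW : ∀ x ∈ Ioo a b, W x = u x ^ 2 * P x)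
    (hr : ∀ x ∈ Ioo a b, r x = A x - (u x)⁻¹) :
    IntegrableOn (fun x => |deriv W x|) (Ioo a b) volume ∧
      IntegrableOn (fun x => |W x * deriv r x|) (Ioo a b) volume := by
  have hs : UniqueDiffOn ℝ (Icc a b) := uniqueDiffOn_Icc hab
  have hderiv : ∀ {v : ℝ → ℝ}, ContDiffOn ℝ 1 v (Icc a b) → ∀ x ∈ Ioo a b,
      HasDerivAt v (derivWithin v (Icc a b) x) x := fun hv x hx =>
    ((hv.differentiableOn one_ne_zero x (Ioo_subset_Icc_self hx)).hasDerivWithinAt).hasDerivAt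
      (Icc_mem_nhds hx.1 hx.2)
  have hnhds : ∀ x ∈ Ioo a b, Ioo a b ∈ 𝓝 x := fun x hx => Ioo_mem_nhds hx.1 hx.2
  have hUP : ContDiffOn ℝ 1 (fun x => u x ^ 2 * P x) (Icc a b) := (hu.pow 2).mul hP
  constructor
  · refine integrableOn_Ioo_of_continuousOn_Icc_of_eqOn
      (hUP.continuousOn_derivWithin hs le_rfl).abs fun x hx => ?_
    have hWx : W =ᶠ[𝓝 x] fun x => u x ^ 2 * P x := eventuallyEq_of_mem (hnhds x hx) hW
    simp only [hWx.deriv_eq, (hderiv hUP x hx).deriv]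
  · have hcont : ContinuousOn
        (fun x => P x * (u x ^ 2 * derivWithin A (Icc a b) x + derivWithin u (Icc a b) x))
        (Icc a b) :=
      hP.continuousOn.mul (((hu.continuousOn.pow 2).mul
        (hA.continuousOn_derivWithin hs le_rfl)).add (hu.continuousOn_derivWithin hs le_rfl))
    refine integrableOn_Ioo_of_continuousOn_Icc_of_eqOn hcont.abs fun x hx => ?_
    have hrx : r =ᶠ[𝓝 x] fun x => A x - (u x)⁻¹ := eventuallyEq_of_mem (hnhds x hx) hr
    have hd := (hderiv hA x hx).fun_sub ((hderiv hu x hx).fun_inv (hu0 x hx))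
    simp only [hrx.deriv_eq, hd.deriv, hW x hx]
    congr 1
    have := hu0 x hx
    field_simp
    ring

theorem pos_on_Icc_of_eventually_le {a b : ℝ} (hab : a < b) {φ : ℝ → ℝ}
    (hφ : ContinuousOn φ (Icc a b)) (hpos : ∀ x ∈ Ioo a b, 0 < φ x)
    (ha : ∃ c > 0, ∀ᶠ x in 𝓝[Ioo a b] a, c ≤ φ x)
    (hb : ∃ c > 0, ∀ᶠ x in 𝓝[Ioo a b] b, c ≤ φ x) :
    ∀ x ∈ Icc a b, 0 < φ x := by
  have hend : ∀ y ∈ Icc a b, (∃ c > 0, ∀ᶠ x in 𝓝[Ioo a b] y, c ≤ φ x) → 0 < φ y := by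
    rintro y hy ⟨c, hc, hev⟩
    have : (𝓝[Ioo a b] y).NeBot := by
      rwa [← mem_closure_iff_nhdsWithin_neBot, closure_Ioo hab.ne]
    exact hc.trans_le (ge_of_tendsto ((hφ y hy).mono Ioo_subset_Icc_self) hev)
  intro x hx
  rcases eq_endpoints_or_mem_Ioo_of_mem_Icc hx with rfl | rfl | hx'
  · exact hend _ hx ha
  · exact hend _ hx hb
  · exact hpos x hx'

section Variation

variable {a b : ℝ} {f g : ℝ → ℝ}

theorem contDiffOn_Hf (hab : a < b) (hf : ContDiffOn ℝ 4 f (Icc a b))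
    (hg : ContDiffOn ℝ 3 g (Icc a b)) : ContDiffOn ℝ 1 (Hf f g (Icc a b)) (Icc a b) := by
  have hs : UniqueDiffOn ℝ (Icc a b) := uniqueDiffOn_Icc hab
  exact ((hg.of_le (by norm_num)).mul (hf.one_iteratedDerivWithin hs (by norm_num))).add
    ((contDiffOn_const.mul (hg.derivWithin hs (by norm_num))).mul
      (hf.one_iteratedDerivWithin hs (by norm_num)))

theorem contDiffOn_Gf (hab : a < b) (hf : ContDiffOn ℝ 4 f (Icc a b))
    (hg : ContDiffOn ℝ 3 g (Icc a b)) : ContDiffOn ℝ 1 (Gf f g (Icc a b)) (Icc a b) := by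
  have hs : UniqueDiffOn ℝ (Icc a b) := uniqueDiffOn_Icc hab
  exact ((contDiffOn_const.mul (hg.of_le (by norm_num))).mul
    (hg.one_iteratedDerivWithin hs (by norm_num))).mul
      ((hf.one_iteratedDerivWithin hs (by norm_num)).pow 2)

theorem integrableOn_variation_W0f (hab : a < b) (hf : ContDiffOn ℝ 4 f (Icc a b))
    (hg : ContDiffOn ℝ 3 g (Icc a b))
    (hf'' : ∀ x ∈ Icc a b, 0 < iteratedDerivWithin 2 f (Icc a b) x)
    (hg0 : ∀ x ∈ Icc a b, g x ≠ 0) (hH : ∀ x ∈ Ioo a b, Hf f g (Icc a b) x ≠ 0) :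
    IntegrableOn (fun x => |deriv (W0f f g (Icc a b)) x|) (Ioo a b) volume ∧
      IntegrableOn (fun x => |W0f f g (Icc a b) x * deriv (r0f f g (Icc a b)) x|)
        (Ioo a b) volume := by
  have hs : UniqueDiffOn ℝ (Icc a b) := uniqueDiffOn_Icc hab
  have hg1 : ContDiffOn ℝ 1 g (Icc a b) := hg.of_le (by norm_num)
  have hF1 := hf.one_iteratedDerivWithin (k := 1) hs (by norm_num)
  have hF2 := hf.one_iteratedDerivWithin (k := 2) hs (by norm_num)
  have hF3 := hf.one_iteratedDerivWithin (k := 3) hs (by norm_num)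
  refine integrableOn_abs_deriv_add_abs_mul_deriv hab
    (u := fun x => Hf f g (Icc a b) x / (3 * g x * iteratedDerivWithin 2 f (Icc a b) x ^ 2))
    (P := fun x => -(g x * iteratedDerivWithin 3 f (Icc a b) x) /
      (3 * iteratedDerivWithin 2 f (Icc a b) x))
    ((contDiffOn_Hf hab hf hg).fun_div ((contDiffOn_const.mul hg1).mul (hF2.pow 2)) ?_)
    ((hg1.mul hF3).neg.fun_div (contDiffOn_const.mul hF2) ?_) hF1 ?_ ?_ ?_
  · intro x hx
    have := hg0 x hx
    have := (hf'' x hx).ne'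
    positivity
  · intro x hx
    have := (hf'' x hx).ne'
    positivity
  all_goals
    intro x hx
    have := hH x hx
    have := hg0 x (Ioo_subset_Icc_self hx)
    have := (hf'' x (Ioo_subset_Icc_self hx)).ne'
  · positivity
  · simp only [W0f]
    field_simp
    ring
  · simp only [r0f, inv_div]

theorem integrableOn_variation_Wpmf (hab : a < b) (hf : ContDiffOn ℝ 4 f (Icc a b))
    (hg : ContDiffOn ℝ 3 g (Icc a b))
    (hf'' : ∀ x ∈ Icc a b, 0 < iteratedDerivWithin 2 f (Icc a b) x)
    (hg0 : ∀ x ∈ Icc a b, g x ≠ 0) (hG : ∀ x ∈ Ioo a b, Gf f g (Icc a b) x ≠ 0)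
    (hpos : ∀ x ∈ Icc a b, 0 < Hf f g (Icc a b) x ^ 2 - Gf f g (Icc a b) x)
    {σ : ℝ} (hσ : σ ^ 2 = 1) :
    IntegrableOn (fun x => |deriv (Wpmf σ f g (Icc a b)) x|) (Ioo a b) volume ∧
      IntegrableOn (fun x => |Wpmf σ f g (Icc a b) x * deriv (rpmf σ f g (Icc a b)) x|)
        (Ioo a b) volume := by
  have hs : UniqueDiffOn ℝ (Icc a b) := uniqueDiffOn_Icc hab
  have hg1 : ContDiffOn ℝ 1 g (Icc a b) := hg.of_le (by norm_num)
  have hg' : ContDiffOn ℝ 1 (derivWithin g (Icc a b)) (Icc a b) :=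
    hg.derivWithin hs (by norm_num)
  have hF1 := hf.one_iteratedDerivWithin (k := 1) hs (by norm_num)
  have hF2 := hf.one_iteratedDerivWithin (k := 2) hs (by norm_num)
  have hHC := contDiffOn_Hf hab hf hg
  have hDC : ContDiffOn ℝ 1
      (fun x => Real.sqrt (Hf f g (Icc a b) x ^ 2 - Gf f g (Icc a b) x)) (Icc a b) :=
    ((hHC.pow 2).sub (contDiffOn_Gf hab hf hg)).sqrt fun x hx => (hpos x hx).ne'
  set u : ℝ → ℝ := fun x =>
    (Hf f g (Icc a b) x - σ * Real.sqrt (Hf f g (Icc a b) x ^ 2 - Gf f g (Icc a b) x)) /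
      (6 * g x * iteratedDerivWithin 2 f (Icc a b) x ^ 2) with hu
  have hconj : ∀ x ∈ Ioo a b,
      2 * iteratedDerivWithin 2 g (Icc a b) x /
        (Hf f g (Icc a b) x + σ * Real.sqrt (Hf f g (Icc a b) x ^ 2 - Gf f g (Icc a b) x)) = u x
      ∧ u x ≠ 0 := by
    intro x hx
    have hxI := Ioo_subset_Icc_self hx
    have hgx := hg0 x hxI
    have hfx := (hf'' x hxI).ne'
    have hprod : (Hf f g (Icc a b) x
          + σ * Real.sqrt (Hf f g (Icc a b) x ^ 2 - Gf f g (Icc a b) x)) *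
        (Hf f g (Icc a b) x
          - σ * Real.sqrt (Hf f g (Icc a b) x ^ 2 - Gf f g (Icc a b) x))
        = Gf f g (Icc a b) x := by
      linear_combination (-σ ^ 2) * Real.sq_sqrt (hpos x hxI).le
        - (Hf f g (Icc a b) x ^ 2 - Gf f g (Icc a b) x) * hσ
    have hne := hprod ▸ hG x hx
    obtain ⟨hplus, hminus⟩ := mul_ne_zero_iff.1 hne
    refine ⟨?_, div_ne_zero hminus (by positivity)⟩
    rw [hu, div_eq_div_iff hplus (by positivity), mul_comm (_ - _), hprod, Gf]
    ring
  refine integrableOn_abs_deriv_add_abs_mul_deriv hab (u := u)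
    (P := fun x => derivWithin g (Icc a b) x - u x * (iteratedDerivWithin 2 f (Icc a b) x * g x))
    ?_ (hg'.sub (ContDiffOn.mul ?_ (hF2.mul hg1))) hF1 (fun x hx => (hconj x hx).2) ?_ ?_
  iterate 2
    refine (hHC.sub (contDiffOn_const.mul hDC)).fun_div
      ((contDiffOn_const.mul hg1).mul (hF2.pow 2)) fun x hx => ?_
    have := hg0 x hx
    have := (hf'' x hx).ne'
    positivity
  · intro x hx
    simp only [← (hconj x hx).1, Wpmf]
    generalize Hf f g (Icc a b) x
      + σ * Real.sqrt (Hf f g (Icc a b) x ^ 2 - Gf f g (Icc a b) x) = v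
    ring
  · intro x hx
    simp only [← (hconj x hx).1, rpmf, inv_div]

end Variation

/-- Integrability of the variation terms `|W₀'| + |W₀ r₀'|` on intervals where
`g'' ≡ 0`, `g ≠ 0`, `H ≠ 0`, and of `|W₊'| + |W₋'| + |W₊ r₊'| + |W₋ r₋'|` on
intervals where `g ≠ 0`, `G ≠ 0`, `H² − G > 0` with `H² − G` not tending to `0`
at either endpoint. -/
theorem stmt17 (a' b' : ℝ) (hab : a' < b') (f g : ℝ → ℝ)
    (hf : ContDiffOn ℝ 4 f (Set.Icc a' b'))
    (hg : ContDiffOn ℝ 3 g (Set.Icc a' b'))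
    (hf'' : ∀ x ∈ Set.Icc a' b', 0 < iteratedDerivWithin 2 f (Set.Icc a' b') x) :
    ((∀ x ∈ Set.Ioo a' b', iteratedDerivWithin 2 g (Set.Icc a' b') x = 0) →
      (∀ x ∈ Set.Icc a' b', g x ≠ 0) →
      (∀ x ∈ Set.Ioo a' b', Hf f g (Set.Icc a' b') x ≠ 0) →
      MeasureTheory.IntegrableOn
        (fun x => |deriv (W0f f g (Set.Icc a' b')) x|
          + |W0f f g (Set.Icc a' b') x * deriv (r0f f g (Set.Icc a' b')) x|)
        (Set.Ioo a' b') MeasureTheory.volume) ∧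
    ((∀ x ∈ Set.Icc a' b', g x ≠ 0) →
      (∀ x ∈ Set.Ioo a' b', Gf f g (Set.Icc a' b') x ≠ 0 ∧
        0 < Hf f g (Set.Icc a' b') x ^ 2 - Gf f g (Set.Icc a' b') x) →
      (∃ c > 0, ∀ᶠ x in nhdsWithin a' (Set.Ioo a' b'),
        c ≤ Hf f g (Set.Icc a' b') x ^ 2 - Gf f g (Set.Icc a' b') x) →
      (∃ c > 0, ∀ᶠ x in nhdsWithin b' (Set.Ioo a' b'),
        c ≤ Hf f g (Set.Icc a' b') x ^ 2 - Gf f g (Set.Icc a' b') x) →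
      MeasureTheory.IntegrableOn
        (fun x => |deriv (Wpmf 1 f g (Set.Icc a' b')) x|
          + |deriv (Wpmf (-1) f g (Set.Icc a' b')) x|
          + |Wpmf 1 f g (Set.Icc a' b') x * deriv (rpmf 1 f g (Set.Icc a' b')) x|
          + |Wpmf (-1) f g (Set.Icc a' b') x * deriv (rpmf (-1) f g (Set.Icc a' b')) x|)
        (Set.Ioo a' b') MeasureTheory.volume) := by
  constructor
  · intro _ hg0 hH
    obtain ⟨hW, hWr⟩ := integrableOn_variation_W0f hab hf hg hf'' hg0 hH
    exact hW.add hWr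
  · intro hg0 hGH ha hb
    have hpos := pos_on_Icc_of_eventually_le hab
      (((contDiffOn_Hf hab hf hg).pow 2).sub (contDiffOn_Gf hab hf hg)).continuousOn
      (fun x hx => (hGH x hx).2) ha hb
    obtain ⟨hW₁, hWr₁⟩ := integrableOn_variation_Wpmf hab hf hg hf'' hg0
      (fun x hx => (hGH x hx).1) hpos (σ := 1) (by norm_num)
    obtain ⟨hW₂, hWr₂⟩ := integrableOn_variation_Wpmf hab hf hg hf'' hg0
      (fun x hx => (hGH x hx).1) hpos (σ := -1) (by norm_num)
    exact ((hW₁.add hW₂).add hWr₁).add hWr₂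
end
end
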